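/- Let Γ be a countable nonamenable discrete group. Then there exists a free ergodic probability measure-preserving action of the free group F₂ on ([0,1]^Γ, Leb^Γ) whose orbit equivalence relation is contained in that of the Bernoulli shift: R(F₂ ↷ [0,1]^Γ) ⊆ R(Γ ↷ [0,1]^Γ). -/

import Mathlib

open MeasureTheory Set BoundedContinuousFunction

noncomputable section

/-- A (discrete) group `G` is amenable if there is a left-invariant mean on `ℓ^∞(G)`:
a positive unital linear functional `φ` with `φ (g · f) = φ f`, where
`(g · f) h = f (g⁻¹ h)`. -/
def IsAmenable (G : Type*) [Group G] : Prop :=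
  letI : TopologicalSpace G := ⊥
  haveI : DiscreteTopology G := ⟨rfl⟩
  ∃ φ : (G →ᵇ ℝ) →ₗ[ℝ] ℝ,
    (∀ f : G →ᵇ ℝ, (∀ x, 0 ≤ f x) → 0 ≤ φ f) ∧
    φ 1 = 1 ∧
    ∀ (g : G) (f : G →ᵇ ℝ),
      φ (f.compContinuous ⟨fun h => g⁻¹ * h, continuous_of_discreteTopology⟩) = φ f

/-- A probability-measure-preserving action of the group `G` on `(X, μ)`. -/
structure PmpAction (G X : Type*) [Group G] [MeasurableSpace X] (μ : Measure X) where
  act : G → X → X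
  act_one : ∀ x, act 1 x = x
  act_mul : ∀ g h x, act (g * h) x = act g (act h x)
  measurable : ∀ g, Measurable (act g)
  measurePreserving : ∀ g, MeasurePreserving (act g) μ μ

variable {G X : Type*} [Group G] [MeasurableSpace X] {μ : Measure X}

/-- The action is (essentially) free. -/
def PmpAction.IsFree (A : PmpAction G X μ) : Prop :=
  ∀ᵐ x ∂μ, ∀ g : G, A.act g x = x → g = 1

/-- The action is ergodic: every invariant measurable set is null or conull. -/
def PmpAction.IsErgodic (A : PmpAction G X μ) : Prop :=
  ∀ s : Set X, MeasurableSet s → (∀ g, A.act g ⁻¹' s = s) → μ s = 0 ∨ μ sᶜ = 0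

/-- The orbit equivalence relation `R(G ↷ X)` of an action, as a subset of `X × X`. -/
def PmpAction.orbitRel (A : PmpAction G X μ) : Set (X × X) :=
  {q | ∃ g : G, q.2 = A.act g q.1}

/-- The Bernoulli shift `Γ ↷ [0,1]^Γ`, `(g · x) h = x (g⁻¹ h)`. -/
def bernoulliShift {Γ : Type*} [Group Γ] (g : Γ) (x : Γ → ℝ) : Γ → ℝ :=
  fun h => x (g⁻¹ * h)

/-- `μ` is the Bernoulli product measure `Leb^Γ` on `[0,1]^Γ` (realized on `Γ → ℝ` as the
product of copies of Lebesgue measure restricted to `[0,1]`). -/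
def IsBernoulliLebProduct {Γ : Type*} (μ : Measure (Γ → ℝ)) : Prop :=
  IsProbabilityMeasure μ ∧
    ∀ (s : Finset Γ) (t : Γ → Set ℝ), (∀ i, MeasurableSet (t i)) →
      μ {x | ∀ i ∈ s, x i ∈ t i} = ∏ i ∈ s, volume (t i ∩ Icc (0:ℝ) 1)

namespace GaboriauLyons

open scoped Pointwise

/-- Countably many measurable maps glued along disjoint measurable sets. -/
theorem exists_glue {Ω ι : Type*} [MeasurableSpace Ω] [Countable ι]
    {E : ι → Set Ω} (hE : ∀ i, MeasurableSet (E i))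
    (hd : ∀ i j x, x ∈ E i → x ∈ E j → i = j) {f : ι → Ω → Ω} (hf : ∀ i, Measurable (f i)) :
    ∃ F : Ω → Ω, Measurable F ∧ (∀ i, ∀ x ∈ E i, F x = f i x) ∧
      ∀ x, (∀ i, x ∉ E i) → F x = x := by
  let t : Option ι → Set Ω := fun o => o.elim (⋃ i, E i)ᶜ E
  let g : Option ι → Ω → Ω := fun o => o.elim id f
  obtain ⟨F, hF, h⟩ := exists_measurable_piecewise t
    (by rintro (_ | i)
        · exact (MeasurableSet.iUnion hE).compl
        · exact hE i) g
    (by rintro (_ | i)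
        · exact measurable_id
        · exact hf i)
    (by rintro (_ | i) (_ | j) hij
        · exact absurd rfl hij
        · rintro x ⟨h1, h2⟩
          exact absurd (mem_iUnion.2 ⟨j, h2⟩) h1
        · rintro x ⟨h2, h1⟩
          exact absurd (mem_iUnion.2 ⟨i, h2⟩) h1
        · rintro x ⟨h1, h2⟩
          exact absurd (congrArg some (hd i j x h1 h2)) hij)
  refine ⟨F, hF, fun i x hx => h (some i) hx, fun x hx => h none ?_⟩
  intro hx'
  obtain ⟨i, hi⟩ := mem_iUnion.1 hx'
  exact hx i hi

/-- The sets chosen by a greedy procedure. -/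
def greedy {Ω : Type*} (M : ℕ → Set Ω) (conf : ℕ → ℕ → Set Ω → Set Ω) (i : ℕ) : Set Ω :=
  M i \ ⋃ j : Fin i, conf i j (greedy M conf j)
termination_by i
decreasing_by exact j.2

theorem mem_greedy {Ω : Type*} {M : ℕ → Set Ω} {conf : ℕ → ℕ → Set Ω → Set Ω} {i : ℕ} {x : Ω} :
    x ∈ greedy M conf i ↔ x ∈ M i ∧ ∀ j < i, x ∉ conf i j (greedy M conf j) := by
  rw [greedy]
  simp only [mem_sdiff, mem_iUnion, not_exists]
  exact and_congr_right fun _ => ⟨fun h j hj => h ⟨j, hj⟩, fun h j => h j j.2⟩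

theorem measurableSet_greedy {Ω : Type*} [MeasurableSpace Ω] {M : ℕ → Set Ω}
    {conf : ℕ → ℕ → Set Ω → Set Ω}
    (hM : ∀ i, MeasurableSet (M i))
    (hc : ∀ i j E, MeasurableSet E → MeasurableSet (conf i j E)) (i : ℕ) :
    MeasurableSet (greedy M conf i) := by
  induction i using Nat.strong_induction_on with
  | _ i ih =>
    rw [greedy]
    exact (hM i).diff (MeasurableSet.iUnion fun j => hc _ _ _ (ih j j.2))

section Orbits

variable {Γ Ω : Type*} [Group Γ] [Countable Γ] [MeasurableSpace Ω]
  [MulAction Γ Ω] [MeasurableConstSMul Γ Ω] {ν : Measure Ω}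

variable (Γ ν) in
/-- `T` is an ergodic Borel equivalence relation whose classes are contained in `Γ`-orbits. -/
structure IsErgodicSubrelation (T : Ω → Ω → Prop) : Prop where
  equivalence : Equivalence T
  orbit : ∀ x y, T x y → ∃ g : Γ, y = g • x
  measurableSet_smul : ∀ g : Γ, MeasurableSet {x | T x (g • x)}
  ergodic : ∀ A : Set Ω, MeasurableSet A → (∀ x y, T x y → (x ∈ A ↔ y ∈ A)) →
    ν A = 0 ∨ ν Aᶜ = 0

theorem IsErgodicSubrelation.saturation {T : Ω → Ω → Prop} (hT : IsErgodicSubrelation Γ ν T)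
    {B : Set Ω} (hB : MeasurableSet B) (hB0 : ν B ≠ 0) :
    ν {x | ∃ y ∈ B, T x y}ᶜ = 0 := by
  have hm : MeasurableSet {x | ∃ y ∈ B, T x y} := by
    have : {x | ∃ y ∈ B, T x y} = ⋃ g : Γ, ({x | T x (g • x)} ∩ (fun x => g • x) ⁻¹' B) := by
      ext x
      simp only [mem_ofPred_eq, mem_iUnion, mem_inter_iff, mem_preimage]
      constructor
      · rintro ⟨y, hy, hxy⟩
        obtain ⟨g, rfl⟩ := hT.orbit x y hxy
        exact ⟨g, hxy, hy⟩
      · rintro ⟨g, h1, h2⟩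
        exact ⟨_, h2, h1⟩
    rw [this]
    exact MeasurableSet.iUnion fun g => (hT.measurableSet_smul g).inter
      (measurable_const_smul g hB)
  refine (hT.ergodic _ hm ?_).resolve_left ?_
  · intro x y hxy
    constructor
    · rintro ⟨z, hz, h⟩
      exact ⟨z, hz, hT.equivalence.trans (hT.equivalence.symm hxy) h⟩
    · rintro ⟨z, hz, h⟩
      exact ⟨z, hz, hT.equivalence.trans hxy h⟩
  · intro h
    exact hB0 (measure_mono_null (fun x hx => (⟨x, hx, hT.equivalence.refl x⟩ : ∃ y ∈ B, T x y)) h)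

/-- Two sets no points of which are related cannot both have positive measure. -/
theorem IsErgodicSubrelation.null_of_not_related {T : Ω → Ω → Prop}
    (hT : IsErgodicSubrelation Γ ν T) {B C : Set Ω} (hB : MeasurableSet B)
    (h : ∀ x ∈ B, ∀ y ∈ C, ¬ T x y) : ν B = 0 ∨ ν C = 0 := by
  by_cases h0 : ν B = 0
  · exact Or.inl h0
  · refine Or.inr (measure_mono_null ?_ (hT.saturation hB h0))
    rintro x hx ⟨y, hy, hxy⟩
    exact h y hy x hx (hT.equivalence.symm hxy)

variable [SMulInvariantMeasure Γ Ω ν]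

/-- Two disjoint sets of the same measure are exchanged by an involution in the full group of an
ergodic relation. -/
theorem IsErgodicSubrelation.exists_swap [IsFiniteMeasure ν] {T : Ω → Ω → Prop}
    (hT : IsErgodicSubrelation Γ ν T) {P Q : Set Ω} (hP : MeasurableSet P) (hQ : MeasurableSet Q)
    (hPQ : Disjoint P Q) (hν : ν P = ν Q) :
    ∃ ψ : Ω → Ω, Measurable ψ ∧ (∀ x, ψ (ψ x) = x) ∧ (∀ x, T x (ψ x)) ∧
      (∀ x, x ∉ P → x ∉ Q → ψ x = x) ∧ (∀ x ∈ P, ψ x ∈ Q ∨ ψ x = x) ∧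
      ν {x | x ∈ P ∧ ψ x ∉ Q} = 0 := by
  obtain ⟨g, hg⟩ := exists_surjective_nat Γ
  let M : ℕ → Set Ω := fun i => P ∩ ({x | T x (g i • x)} ∩ (fun x => g i • x) ⁻¹' Q)
  let conf : ℕ → ℕ → Set Ω → Set Ω := fun i j E =>
    E ∪ (fun x => g i • x) ⁻¹' (g j • E)
  have hM : ∀ i, MeasurableSet (M i) := fun i =>
    hP.inter ((hT.measurableSet_smul _).inter (measurable_const_smul (g i) hQ))
  have hc : ∀ i j E, MeasurableSet E → MeasurableSet (conf i j E) := fun i j E hE =>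
    hE.union (measurable_const_smul (g i) (hE.const_smul (g j)))
  set E := greedy M conf with hEdef
  have hEm : ∀ i, MeasurableSet (E i) := measurableSet_greedy hM hc
  have hEM : ∀ i x, x ∈ E i → x ∈ M i := fun i x hx => (mem_greedy.1 hx).1
  have hd1 : ∀ i j x, x ∈ E i → x ∈ E j → i = j := by
    intro i j x hi hj
    rcases lt_trichotomy i j with h | h | h
    · exact absurd (Or.inl hi) ((mem_greedy.1 hj).2 i h)
    · exact h
    · exact absurd (Or.inl hj) ((mem_greedy.1 hi).2 j h)
  have hd2 : ∀ i j x y, x ∈ E i → y ∈ E j → g i • x = g j • y → i = j := by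
    intro i j x y hi hj hxy
    rcases lt_trichotomy i j with h | h | h
    · exact absurd (Or.inr ⟨x, hi, hxy⟩) ((mem_greedy.1 hj).2 i h)
    · exact h
    · exact absurd (Or.inr ⟨y, hj, hxy.symm⟩) ((mem_greedy.1 hi).2 j h)
  let D : ℕ × Bool → Set Ω := fun p => if p.2 then E p.1 else g p.1 • E p.1
  let f : ℕ × Bool → Ω → Ω := fun p x => if p.2 then g p.1 • x else (g p.1)⁻¹ • x
  have hDm : ∀ p, MeasurableSet (D p) := by
    rintro ⟨i, _ | _⟩
    · exact (hEm i).const_smul (g i)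
    · exact hEm i
  have hfm : ∀ p, Measurable (f p) := by
    rintro ⟨i, _ | _⟩
    · exact measurable_const_smul (g i)⁻¹
    · exact measurable_const_smul (g i)
  have hdj := Set.disjoint_left.1 hPQ
  obtain ⟨ψ, hψm, hψ, hψ'⟩ := exists_glue hDm (by
    rintro ⟨i, _ | _⟩ ⟨j, _ | _⟩ x hx hy
    · obtain ⟨u, hu, rfl⟩ := hx
      obtain ⟨v, hv, huv⟩ := hy
      exact congrArg (fun k => (k, false)) (hd2 i j u v hu hv huv.symm)
    · obtain ⟨u, hu, rfl⟩ := hx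
      exact absurd (hEM i u hu).2.2 (hdj (hEM j _ hy).1)
    · obtain ⟨u, hu, rfl⟩ := hy
      exact absurd (hEM j u hu).2.2 (hdj (hEM i _ hx).1)
    · exact congrArg (fun k => (k, true)) (hd1 i j x hx hy)) hfm
  have hψ1 : ∀ i, ∀ x ∈ E i, ψ x = g i • x := fun i x hx => hψ (i, true) x hx
  have hψ2 : ∀ i, ∀ x ∈ E i, ψ (g i • x) = x := fun i x hx => by
    rw [hψ (i, false) (g i • x) ⟨x, hx, rfl⟩]
    exact inv_smul_smul _ _
  have hcases : ∀ x, (∃ i, x ∈ E i) ∨ (∃ i, ∃ y ∈ E i, x = g i • y) ∨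
      ((∀ i, x ∉ E i) ∧ (∀ i, x ∉ g i • E i) ∧ ψ x = x) := by
    intro x
    by_cases h1 : ∃ i, x ∈ E i
    · exact Or.inl h1
    by_cases h2 : ∃ i, ∃ y ∈ E i, x = g i • y
    · exact Or.inr (Or.inl h2)
    push Not at h1 h2
    have h2' : ∀ i, x ∉ g i • E i := by
      rintro i ⟨y, hy, hxy⟩
      exact h2 i y hy hxy.symm
    refine Or.inr (Or.inr ⟨h1, h2', hψ' x ?_⟩)
    rintro ⟨i, _ | _⟩
    · exact h2' i
    · exact h1 i
  refine ⟨ψ, hψm, ?_, ?_, ?_, ?_, ?_⟩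
  · intro x
    rcases hcases x with ⟨i, hi⟩ | ⟨i, y, hy, rfl⟩ | ⟨-, -, h⟩
    · rw [hψ1 i x hi, hψ2 i x hi]
    · rw [hψ2 i y hy, hψ1 i y hy]
    · rw [h, h]
  · intro x
    rcases hcases x with ⟨i, hi⟩ | ⟨i, y, hy, rfl⟩ | ⟨-, -, h⟩
    · rw [hψ1 i x hi]
      exact (hEM i x hi).2.1
    · rw [hψ2 i y hy]
      exact hT.equivalence.symm (hEM i y hy).2.1
    · rw [h]
      exact hT.equivalence.refl x
  · intro x hxP hxQ
    rcases hcases x with ⟨i, hi⟩ | ⟨i, y, hy, rfl⟩ | ⟨-, -, h⟩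
    · exact absurd (hEM i x hi).1 hxP
    · exact absurd (hEM i y hy).2.2 hxQ
    · exact h
  · intro x hxP
    rcases hcases x with ⟨i, hi⟩ | ⟨i, y, hy, rfl⟩ | ⟨-, -, h⟩
    · left
      rw [hψ1 i x hi]
      exact (hEM i x hi).2.2
    · exact absurd (hEM i y hy).2.2 (hdj hxP)
    · exact Or.inr h
  · have hsub : {x | x ∈ P ∧ ψ x ∉ Q} ⊆ P \ ⋃ i, E i := by
      rintro x ⟨hxP, hxQ⟩
      refine ⟨hxP, fun hx => ?_⟩
      obtain ⟨i, hi⟩ := mem_iUnion.1 hx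
      apply hxQ
      rw [hψ1 i x hi]
      exact (hEM i x hi).2.2
    refine measure_mono_null hsub ?_
    have hU : MeasurableSet (⋃ i, E i) := MeasurableSet.iUnion hEm
    have hU' : MeasurableSet (⋃ i, g i • E i) :=
      MeasurableSet.iUnion fun i => (hEm i).const_smul (g i)
    have hUU : ν (⋃ i, g i • E i) = ν (⋃ i, E i) := by
      rw [measure_iUnion _ hEm, measure_iUnion _ fun i => (hEm i).const_smul (g i)]
      · exact tsum_congr fun n => measure_smul ν (g n) _
      · intro i j hij
        refine Set.disjoint_left.2 ?_
        rintro _ ⟨x, hx, rfl⟩ ⟨y, hy, hxy⟩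
        exact hij (hd2 i j x y hx hy hxy.symm)
      · intro i j hij
        refine Set.disjoint_left.2 ?_
        intro x hx hy
        exact hij (hd1 i j x hx hy)
    have hUP : (⋃ i, E i) ⊆ P := iUnion_subset fun i x hx => (hEM i x hx).1
    have hUQ : (⋃ i, g i • E i) ⊆ Q := by
      refine iUnion_subset fun i => ?_
      rintro _ ⟨x, hx, rfl⟩
      exact (hEM i x hx).2.2
    have heq : ν (P \ ⋃ i, E i) = ν (Q \ ⋃ i, g i • E i) := by
      rw [measure_sdiff hUP hU.nullMeasurableSet (measure_ne_top _ _),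
        measure_sdiff hUQ hU'.nullMeasurableSet (measure_ne_top _ _), hν, hUU]
    refine (hT.null_of_not_related (hP.diff hU) (C := Q \ ⋃ i, g i • E i) ?_).elim id
      fun h => heq.trans h
    rintro x ⟨hxP, hxE⟩ y ⟨hyQ, hyE⟩ hxy
    obtain ⟨a, rfl⟩ := hT.orbit x y hxy
    obtain ⟨i, rfl⟩ := hg a
    apply hxE
    refine mem_iUnion.2 ⟨i, mem_greedy.2 ⟨⟨hxP, hxy, hyQ⟩, ?_⟩⟩
    rintro j hj (h | h)
    · exact hxE (mem_iUnion.2 ⟨j, h⟩)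
    · exact hyE (mem_iUnion.2 ⟨j, h⟩)

variable [StandardBorelSpace Ω]

/-- A measurable map that is injective on `S` and moves points of `S` along `Γ`-orbits preserves
the measure of `S`. -/
theorem measure_image_of_orbit {f : Ω → Ω} (hf : Measurable f) {S : Set Ω}
    (hS : MeasurableSet S) (hinj : InjOn f S) (horb : ∀ x ∈ S, ∃ g : Γ, f x = g • x) :
    ν (f '' S) = ν S := by
  obtain ⟨g, hg⟩ := exists_surjective_nat Γ
  set E : ℕ → Set Ω := fun n => {x | x ∈ S ∧ f x = g n • x} with hE
  have hEm : ∀ n, MeasurableSet (E n) := fun n =>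
    hS.inter (measurableSet_eq_fun hf (measurable_const_smul (g n)))
  have hcov : ⋃ n, disjointed E n = S := by
    rw [iUnion_disjointed]
    ext x
    simp only [hE, mem_iUnion, mem_ofPred_eq]
    constructor
    · rintro ⟨n, h, -⟩
      exact h
    · intro hx
      obtain ⟨a, ha⟩ := horb x hx
      obtain ⟨n, rfl⟩ := hg a
      exact ⟨n, hx, ha⟩
  have hdm : ∀ n, MeasurableSet (disjointed E n) := fun n => MeasurableSet.disjointed hEm n
  have hsub : ∀ n, disjointed E n ⊆ E n := fun n => disjointed_subset E n
  have himg : ∀ n, f '' disjointed E n = g n • disjointed E n := by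
    intro n
    apply image_congr
    intro x hx
    exact (hsub n hx).2
  have h1 : f '' S = ⋃ n, g n • disjointed E n := by
    conv_lhs => rw [← hcov]
    rw [image_iUnion]
    exact iUnion_congr himg
  rw [h1, measure_iUnion, ← hcov, measure_iUnion (disjoint_disjointed E) hdm]
  · exact tsum_congr fun n => measure_smul ν (g n) _
  · intro i j hij
    rw [Function.onFun, ← himg, ← himg]
    rw [Set.disjoint_left]
    rintro _ ⟨x, hx, rfl⟩ ⟨y, hy, hxy⟩
    have : y = x := hinj (hsub j hy).1 (hsub i hx).1 hxy
    subst this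
    exact Set.disjoint_left.1 (disjoint_disjointed E hij) hx hy
  · intro n
    exact (hdm n).const_smul (g n)

/-- A measurable map that is injective and moves points along orbits on a conull set agrees with
a bijection on an invariant conull set. -/
theorem exists_completion [Nonempty Ω] [IsFiniteMeasure ν] {f : Ω → Ω} (hf : Measurable f)
    {S : Set Ω} (hS : MeasurableSet S) (hS0 : ν Sᶜ = 0) (hinj : InjOn f S)
    (horb : ∀ x ∈ S, ∃ g : Γ, f x = g • x) :
    ∃ (F : Ω ≃ Ω) (Y : Set Ω), Measurable F ∧ Measurable F.symm ∧ MeasurableSet Y ∧ Y ⊆ S ∧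
      ν Yᶜ = 0 ∧ (∀ (g : Γ) (x : Ω), x ∈ Y → g • x ∈ Y) ∧ (∀ x ∈ Y, F x = f x) ∧
      ∀ x ∉ Y, F x = x := by
  classical
  have hfS : MeasurableSet (f '' S) := hS.image_of_measurable_injOn hf hinj
  have hfS0 : ν (f '' S)ᶜ = 0 := by
    rw [measure_compl hfS (measure_ne_top _ _), measure_image_of_orbit hf hS hinj horb,
      ← measure_compl hS (measure_ne_top _ _), hS0]
  let Y : Set Ω := ⋂ g : Γ, (fun x => g • x) ⁻¹' (S ∩ f '' S)
  have hYmem : ∀ x, x ∈ Y ↔ ∀ g : Γ, g • x ∈ S ∧ g • x ∈ f '' S := by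
    intro x
    simp only [Y, mem_iInter, mem_preimage, mem_inter_iff]
  have hY : MeasurableSet Y :=
    MeasurableSet.iInter fun g => measurable_const_smul g (hS.inter hfS)
  have hY0 : ν Yᶜ = 0 := by
    rw [compl_iInter]
    refine measure_iUnion_null fun g => ?_
    rw [← preimage_compl, measure_preimage_smul, compl_inter]
    exact measure_union_null hS0 hfS0
  have hinv : ∀ (g : Γ) (x : Ω), x ∈ Y → g • x ∈ Y := by
    intro g x hx
    rw [hYmem] at hx ⊢
    intro h
    rw [smul_smul]
    exact hx (h * g)
  have hYS : Y ⊆ S := fun x hx => by simpa using ((hYmem x).1 hx 1).1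
  have hfY : ∀ x ∈ Y, f x ∈ Y := fun x hx => by
    obtain ⟨g, hg⟩ := horb x (hYS hx)
    rw [hg]
    exact hinv g x hx
  let F₀ : Ω → Ω := fun x => if x ∈ Y then f x else x
  have hF1 : ∀ x ∈ Y, F₀ x = f x := fun x hx => if_pos hx
  have hF2 : ∀ x ∉ Y, F₀ x = x := fun x hx => if_neg hx
  have hFm : Measurable F₀ := Measurable.ite hY hf measurable_id
  have hbij : Function.Bijective F₀ := by
    constructor
    · intro x y hxy
      by_cases hx : x ∈ Y <;> by_cases hy : y ∈ Y
      · rw [hF1 x hx, hF1 y hy] at hxy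
        exact hinj (hYS hx) (hYS hy) hxy
      · rw [hF1 x hx, hF2 y hy] at hxy
        exact absurd (hxy ▸ hfY x hx) hy
      · rw [hF2 x hx, hF1 y hy] at hxy
        exact absurd (hxy ▸ hfY y hy) hx
      · rwa [hF2 x hx, hF2 y hy] at hxy
    · intro y
      by_cases hy : y ∈ Y
      · obtain ⟨x, hx, hxy⟩ := ((hYmem y).1 hy 1).2
        rw [one_smul] at hxy
        obtain ⟨g, hg⟩ := horb x hx
        have : x ∈ Y := by
          have h := hinv g⁻¹ y hy
          rwa [← hxy, hg, inv_smul_smul] at h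
        exact ⟨x, (hF1 x this).trans hxy⟩
      · exact ⟨y, hF2 y hy⟩
  refine ⟨Equiv.ofBijective F₀ hbij, Y, hFm, ?_, hY, hYS, hY0, hinv, hF1, hF2⟩
  intro s hs
  rw [← Equiv.image_eq_preimage_symm]
  exact (hFm.measurableEmbedding hbij.1).measurableSet_image.2 hs

theorem measurePreserving_of_orbit {F : Ω ≃ Ω} (hF : Measurable F) (hF' : Measurable F.symm)
    (horb : ∀ x, ∃ g : Γ, F x = g • x) : MeasurePreserving F ν ν := by
  refine ⟨hF, ?_⟩
  ext s hs
  rw [Measure.map_apply hF hs, ← Equiv.image_symm_eq_preimage]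
  refine measure_image_of_orbit (Γ := Γ) hF' hs F.symm.injective.injOn fun x _ => ?_
  obtain ⟨g, hg⟩ := horb (F.symm x)
  refine ⟨g⁻¹, ?_⟩
  rw [Equiv.apply_symm_apply] at hg
  rw [hg, inv_smul_smul, ← hg]

end Orbits

/-- Sums of a function along the fibres of a tower. -/
def sumAlong {Ω : Type*} (ψ : ℕ → Ω → Ω) (u : Ω → ENNReal) : ℕ → Ω → ENNReal
  | 0, x => u x
  | n + 1, x => sumAlong ψ u n x + sumAlong ψ u n (ψ n x)

theorem sumAlong_add {Ω : Type*} (ψ : ℕ → Ω → Ω) (u v : Ω → ENNReal) (n : ℕ) (x : Ω) :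
    sumAlong ψ (u + v) n x = sumAlong ψ u n x + sumAlong ψ v n x := by
  induction n generalizing x with
  | zero => rfl
  | succ n ih =>
    simp only [sumAlong, ih]
    ring

theorem sumAlong_const {Ω : Type*} (ψ : ℕ → Ω → Ω) (c : ENNReal) (n : ℕ) (x : Ω) :
    sumAlong ψ (fun _ => c) n x = 2 ^ n * c := by
  induction n generalizing x with
  | zero => simp [sumAlong]
  | succ n ih =>
    simp only [sumAlong, ih, pow_succ]
    ring

section Tower

variable {Γ Ω : Type*} [Group Γ] [Countable Γ] [MeasurableSpace Ω]
  [MulAction Γ Ω] [MeasurableConstSMul Γ Ω] {ν : Measure Ω}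

variable (ν) in
/-- A decreasing sequence of sets together with involutions `ψ n` exchanging `D (n + 1)` and
`D n \ D (n + 1)`. -/
structure IsTower (T : Ω → Ω → Prop) (D : ℕ → Set Ω) (ψ : ℕ → Ω → Ω) : Prop where
  zero : D 0 = univ
  measurableSet : ∀ n, MeasurableSet (D n)
  anti : ∀ n, D (n + 1) ⊆ D n
  measure_eq : ∀ n, ν (D (n + 1)) = ν (D n \ D (n + 1))
  measurable : ∀ n, Measurable (ψ n)
  involutive : ∀ n x, ψ n (ψ n x) = x
  related : ∀ n x, T x (ψ n x)
  eq_self : ∀ n x, x ∉ D n → ψ n x = x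
  maps : ∀ n, ∀ x ∈ D (n + 1), ψ n x ∈ D n \ D (n + 1) ∨ ψ n x = x
  null : ∀ n, ν {x | x ∈ D (n + 1) ∧ ψ n x ∉ D n \ D (n + 1)} = 0

/-- The composition `ψ (n - 1) ∘ ⋯ ∘ ψ 0`. -/
def compUp (ψ : ℕ → Ω → Ω) : ℕ → Ω → Ω
  | 0, x => x
  | n + 1, x => ψ n (compUp ψ n x)

/-- The composition `ψ 0 ∘ ⋯ ∘ ψ (n - 1)`. -/
def compDown (ψ : ℕ → Ω → Ω) : ℕ → Ω → Ω
  | 0, x => x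
  | n + 1, x => compDown ψ n (ψ n x)

namespace IsTower

variable {T : Ω → Ω → Prop} {D : ℕ → Set Ω} {ψ : ℕ → Ω → Ω}

theorem measurable_sumAlong (h : IsTower ν T D ψ) {u : Ω → ENNReal} (hu : Measurable u) (n : ℕ) :
    Measurable (sumAlong ψ u n) := by
  induction n with
  | zero => exact hu
  | succ n ih => exact ih.add (ih.comp (h.measurable n))

theorem measurable_compUp (h : IsTower ν T D ψ) (n : ℕ) : Measurable (compUp ψ n) := by
  induction n with
  | zero => exact measurable_id
  | succ n ih => exact (h.measurable n).comp ih

theorem compUp_compDown (h : IsTower ν T D ψ) (n : ℕ) (x : Ω) :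
    compUp ψ n (compDown ψ n x) = x := by
  induction n generalizing x with
  | zero => rfl
  | succ n ih =>
    change ψ n (compUp ψ n (compDown ψ n (ψ n x))) = x
    rw [ih, h.involutive]

theorem compDown_compUp (h : IsTower ν T D ψ) (n : ℕ) (x : Ω) :
    compDown ψ n (compUp ψ n x) = x := by
  induction n generalizing x with
  | zero => rfl
  | succ n ih =>
    change compDown ψ n (ψ n (ψ n (compUp ψ n x))) = x
    rw [h.involutive, ih]

theorem related_compUp (h : IsTower ν T D ψ) (hT : Equivalence T) (n : ℕ) (x : Ω) :
    T x (compUp ψ n x) := by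
  induction n with
  | zero => exact hT.refl x
  | succ n ih => exact hT.trans ih (h.related n _)

theorem antitone (h : IsTower ν T D ψ) : Antitone D := antitone_nat_of_succ_le h.anti

theorem compUp_stable (h : IsTower ν T D ψ) {n m : ℕ} (hnm : n ≤ m) {x : Ω}
    (hx : compUp ψ n x ∉ D n) : compUp ψ m x = compUp ψ n x := by
  induction m, hnm using Nat.le_induction with
  | base => rfl
  | succ m hm ih =>
    change ψ m (compUp ψ m x) = _
    rw [ih]
    exact h.eq_self m _ fun h' => hx (h.antitone hm h')

theorem measure_D [IsProbabilityMeasure ν] (h : IsTower ν T D ψ) (n : ℕ) :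
    ν (D n) * 2 ^ n = 1 := by
  induction n with
  | zero => simp [h.zero]
  | succ n ih =>
    have : ν (D n) = ν (D (n + 1)) + ν (D (n + 1)) := by
      conv_rhs => rw [h.measure_eq n]
      rw [← measure_inter_add_sdiff (D n) (h.measurableSet (n + 1)),
        inter_eq_right.2 (h.anti n), h.measure_eq n]
    rw [← ih, this, pow_succ]
    ring

/-- The invariance passes from the limit of the `compUp ψ n` to the involutions `ψ n`. -/
theorem mem_iff (h : IsTower ν T D ψ) {A : Set Ω}
    (hA : ∀ n y, compUp ψ n y ∉ D n → (y ∈ A ↔ compUp ψ n y ∈ A)) (n : ℕ) :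
    (∀ x ∈ D n, x ∈ A ↔ compDown ψ n x ∈ A) ∧ ∀ x ∈ D (n + 1), x ∈ A ↔ ψ n x ∈ A := by
  have key : ∀ n, (∀ x ∈ D n, x ∈ A ↔ compDown ψ n x ∈ A) →
      ∀ x ∈ D (n + 1), x ∈ A ↔ ψ n x ∈ A := by
    intro n ih x hx
    rcases h.maps n x hx with h1 | h1
    · rw [ih x (h.anti n hx)]
      have h2 := hA (n + 1) (compDown ψ n x)
      have h3 : compUp ψ (n + 1) (compDown ψ n x) = ψ n x := by
        change ψ n (compUp ψ n (compDown ψ n x)) = _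
        rw [h.compUp_compDown]
      rw [h3] at h2
      exact h2 h1.2
    · rw [h1]
  induction n with
  | zero => exact ⟨fun x _ => Iff.rfl, key 0 fun x _ => Iff.rfl⟩
  | succ n ih =>
    have h1 : ∀ x ∈ D (n + 1), x ∈ A ↔ compDown ψ (n + 1) x ∈ A := by
      intro x hx
      rw [ih.2 x hx]
      refine ih.1 (ψ n x) ?_
      rcases h.maps n x hx with h1 | h1
      · exact h1.1
      · rw [h1]
        exact h.anti n hx
    exact ⟨h1, key (n + 1) h1⟩

theorem map_mem (h : IsTower ν T D ψ) {n : ℕ} {x : Ω} (hx : x ∈ D (n + 1)) : ψ n x ∈ D n := by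
  rcases h.maps n x hx with h1 | h1
  · exact h1.1
  · rw [h1]
    exact h.anti n hx

/-- Two functions agreeing on an invariant set have the same sums there. -/
theorem sumAlong_congr (h : IsTower ν T D ψ) {A : Set Ω}
    (hA : ∀ n, ∀ x ∈ D (n + 1), x ∈ A ↔ ψ n x ∈ A) {u v : Ω → ENNReal}
    (huv : ∀ x ∈ A, u x = v x) (n : ℕ) :
    ∀ x ∈ D n, x ∈ A → sumAlong ψ u n x = sumAlong ψ v n x := by
  induction n with
  | zero => exact fun x _ hx => huv x hx
  | succ n ih =>
    intro x hx hxA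
    simp only [sumAlong]
    rw [ih x (h.anti n hx) hxA, ih _ (h.map_mem hx) ((hA n x hx).1 hxA)]

variable [SMulInvariantMeasure Γ Ω ν] [StandardBorelSpace Ω]

theorem measurePreserving (h : IsTower ν T D ψ) (hT : IsErgodicSubrelation Γ ν T) (n : ℕ) :
    MeasurePreserving (ψ n) ν ν :=
  measurePreserving_of_orbit (Γ := Γ) (F := Function.Involutive.toPerm (ψ n) (h.involutive n))
    (h.measurable n) (h.measurable n) fun x => hT.orbit _ _ (h.related n x)

theorem lintegral_comp [IsFiniteMeasure ν] (h : IsTower ν T D ψ)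
    (hT : IsErgodicSubrelation Γ ν T) {u : Ω → ENNReal} (hu : Measurable u) (n : ℕ) :
    ∫⁻ x in D (n + 1), u (ψ n x) ∂ν = ∫⁻ x in D n \ D (n + 1), u x ∂ν := by
  have hQ : MeasurableSet (D n \ D (n + 1)) := (h.measurableSet n).diff (h.measurableSet _)
  have hmp := h.measurePreserving hT n
  rw [← hmp.setLIntegral_comp_preimage hQ hu]
  refine setLIntegral_congr ?_
  refine ae_eq_of_ae_subset_of_measure_ge ?_ ?_ (h.measurableSet _).nullMeasurableSet
    (measure_ne_top _ _)
  · have := h.null n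
    rw [ae_le_set]
    refine measure_mono_null ?_ this
    exact fun x hx => ⟨hx.1, hx.2⟩
  · rw [hmp.measure_preimage hQ.nullMeasurableSet, h.measure_eq]

theorem lintegral_sumAlong [IsFiniteMeasure ν] (h : IsTower ν T D ψ)
    (hT : IsErgodicSubrelation Γ ν T) {u : Ω → ENNReal} (hu : Measurable u) (n : ℕ) :
    ∫⁻ x in D n, sumAlong ψ u n x ∂ν = ∫⁻ x, u x ∂ν := by
  induction n with
  | zero => simp [h.zero, sumAlong]
  | succ n ih =>
    have hm := h.measurable_sumAlong hu n
    simp only [sumAlong]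
    rw [lintegral_add_left hm, h.lintegral_comp hT hm, ← ih,
      ← lintegral_inter_add_sdiff _ (D n) (h.measurableSet (n + 1)), inter_eq_right.2 (h.anti n)]

/-- A set invariant under the involutions of the tower has density constant along the tower. -/
theorem measure_inter [IsFiniteMeasure ν] (h : IsTower ν T D ψ)
    (hT : IsErgodicSubrelation Γ ν T) {A : Set Ω} (hAm : MeasurableSet A)
    (hA : ∀ n, ∀ x ∈ D (n + 1), x ∈ A ↔ ψ n x ∈ A) (n : ℕ) :
    2 ^ n * ν (A ∩ D n) = ν A ∧ 2 ^ (n + 1) * ν (A ∩ (D n \ D (n + 1))) = ν A := by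
  have key : ∀ n, 2 ^ n * ν (A ∩ D n) = ν A := by
    intro n
    rw [← lintegral_indicator_one hAm, ← h.lintegral_sumAlong hT (measurable_one.indicator hAm) n]
    have : ∀ x ∈ D n, sumAlong ψ (A.indicator 1) n x = A.indicator (fun _ => 2 ^ n) x := by
      intro x hx
      by_cases hxA : x ∈ A
      · rw [h.sumAlong_congr hA (v := fun _ => 1) (fun x hx => by simp [hx]) n x hx hxA,
          sumAlong_const, indicator_of_mem hxA, mul_one]
      · have hA' : ∀ n, ∀ x ∈ D (n + 1), x ∈ Aᶜ ↔ ψ n x ∈ Aᶜ := fun n x hx =>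
          not_congr (hA n x hx)
        rw [h.sumAlong_congr hA' (v := fun _ => 0) (fun x hx => indicator_of_notMem hx _) n x hx hxA,
          sumAlong_const, indicator_of_notMem hxA, mul_zero]
    rw [setLIntegral_congr_fun (h.measurableSet n) this, lintegral_indicator hAm,
      Measure.restrict_restrict hAm, setLIntegral_const]
  refine ⟨key n, ?_⟩
  have h1 : ν (A ∩ (D n \ D (n + 1))) = ν (A ∩ D (n + 1)) := by
    have h2 := h.lintegral_comp hT (measurable_one.indicator hAm) n
    have h3 : ∀ x ∈ D (n + 1), (A.indicator 1 (ψ n x) : ENNReal) = A.indicator 1 x := by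
      intro x hx
      by_cases hxA : x ∈ A
      · rw [indicator_of_mem hxA, indicator_of_mem ((hA n x hx).1 hxA)]
        rfl
      · rw [indicator_of_notMem hxA, indicator_of_notMem fun h' => hxA ((hA n x hx).2 h')]
    rw [setLIntegral_congr_fun (h.measurableSet _) h3, lintegral_indicator_one hAm,
      lintegral_indicator_one hAm, Measure.restrict_apply hAm, Measure.restrict_apply hAm] at h2
    exact h2.symm
  rw [h1, key]

end IsTower

variable [SMulInvariantMeasure Γ Ω ν]

theorem exists_half [IsFiniteMeasure ν]
    (hna : ∀ E : Set Ω, MeasurableSet E → ∀ c ≤ ν E, ∃ E' ⊆ E, MeasurableSet E' ∧ ν E' = c)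
    {D C : Set Ω} (hD : MeasurableSet D) (hC : MeasurableSet C) :
    ∃ P ⊆ D, MeasurableSet P ∧ ν P = ν (D \ P) ∧ (Disjoint P C ∨ D \ P ⊆ C) := by
  have hsum := measure_inter_add_sdiff (μ := ν) D hC
  have key : ∀ P ⊆ D, MeasurableSet P → ν P = ν D / 2 → ν (D \ P) = ν D / 2 := by
    intro P hP hPm h
    rw [measure_sdiff hP hPm.nullMeasurableSet (measure_ne_top _ _), h]
    exact ENNReal.sub_half (measure_ne_top _ _)
  by_cases h : ν D / 2 ≤ ν (D ∩ C)
  · obtain ⟨Q, hQ, hQm, hQν⟩ := hna _ (hD.inter hC) _ h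
    have hQD : Q ⊆ D := hQ.trans inter_subset_left
    refine ⟨D \ Q, sdiff_subset, hD.diff hQm, ?_, Or.inr ?_⟩
    · rw [sdiff_sdiff_cancel_left hQD, key Q hQD hQm hQν, hQν]
    · rw [sdiff_sdiff_cancel_left hQD]
      exact hQ.trans inter_subset_right
  · have h' : ν D / 2 ≤ ν (D \ C) := by
      by_contra h2
      have := ENNReal.add_lt_add (not_le.1 h) (not_le.1 h2)
      rw [hsum, ENNReal.add_halves] at this
      exact lt_irrefl _ this
    obtain ⟨P, hP, hPm, hPν⟩ := hna _ (hD.diff hC) _ h'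
    have hPD : P ⊆ D := hP.trans sdiff_subset
    refine ⟨P, hPD, hPm, ?_, Or.inl ?_⟩
    · rw [key P hPD hPm hPν, hPν]
    · exact Set.disjoint_left.2 fun x hx => (hP hx).2

theorem exists_tower [IsFiniteMeasure ν] {T : Ω → Ω → Prop} (hT : IsErgodicSubrelation Γ ν T)
    (hna : ∀ E : Set Ω, MeasurableSet E → ∀ c ≤ ν E, ∃ E' ⊆ E, MeasurableSet E' ∧ ν E' = c)
    {B : ℕ → Set Ω} (hB : ∀ j, MeasurableSet (B j)) :
    ∃ (D : ℕ → Set Ω) (ψ : ℕ → Ω → Ω), IsTower ν T D ψ ∧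
      ∀ n, Disjoint (D (n + 1)) {x | 2 ^ n < 2 * sumAlong ψ ((B n).indicator 1) n x} ∨
        D n \ D (n + 1) ⊆ {x | 2 ^ n < 2 * sumAlong ψ ((B n).indicator 1) n x} := by
  have step : ∀ D C : Set Ω, ∃ (P : Set Ω) (ψ : Ω → Ω), MeasurableSet D → MeasurableSet C →
      (P ⊆ D ∧ MeasurableSet P ∧ ν P = ν (D \ P) ∧ (Disjoint P C ∨ D \ P ⊆ C)) ∧
      Measurable ψ ∧ (∀ x, ψ (ψ x) = x) ∧ (∀ x, T x (ψ x)) ∧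
      (∀ x, x ∉ P → x ∉ D \ P → ψ x = x) ∧ (∀ x ∈ P, ψ x ∈ D \ P ∨ ψ x = x) ∧
      ν {x | x ∈ P ∧ ψ x ∉ D \ P} = 0 := by
    intro D C
    by_cases h : MeasurableSet D ∧ MeasurableSet C
    · obtain ⟨P, hPD, hPm, hPν, hPC⟩ := exists_half hna h.1 h.2
      obtain ⟨ψ, hψ⟩ := hT.exists_swap hPm (h.1.diff hPm) disjoint_sdiff_right hPν
      exact ⟨P, ψ, fun _ _ => ⟨⟨hPD, hPm, hPν, hPC⟩, hψ⟩⟩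
    · exact ⟨∅, id, fun h1 h2 => absurd ⟨h1, h2⟩ h⟩
  choose P ψ₀ hstep using step
  let C : ℕ → (ℕ → Ω → ENNReal) → Set Ω := fun n R => {x | 2 ^ n < 2 * R n x}
  let st : ℕ → Set Ω × (ℕ → Ω → ENNReal) := fun n =>
    Nat.rec (univ, fun j => (B j).indicator 1)
      (fun n s => (P s.1 (C n s.2), fun j x => s.2 j x + s.2 j (ψ₀ s.1 (C n s.2) x))) n
  let D : ℕ → Set Ω := fun n => (st n).1
  let ψ : ℕ → Ω → Ω := fun n => ψ₀ (D n) (C n (st n).2)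
  have hD : ∀ n, D (n + 1) = P (D n) (C n (st n).2) := fun n => rfl
  have hR : ∀ n j, (st n).2 j = sumAlong ψ ((B j).indicator 1) n := by
    intro n
    induction n with
    | zero => exact fun j => rfl
    | succ n ih =>
      intro j
      funext x
      change (st n).2 j x + (st n).2 j (ψ n x) = _
      rw [ih]
      rfl
  have hm : ∀ n, MeasurableSet (D n) ∧ ∀ j, Measurable ((st n).2 j) := by
    intro n
    induction n with
    | zero => exact ⟨MeasurableSet.univ, fun j => measurable_one.indicator (hB j)⟩
    | succ n ih =>
      have hC : MeasurableSet (C n (st n).2) :=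
        measurableSet_lt measurable_const ((ih.2 n).const_mul 2)
      have h := hstep (D n) _ ih.1 hC
      exact ⟨h.1.2.1, fun j => (ih.2 j).add ((ih.2 j).comp h.2.1)⟩
  have hC : ∀ n, MeasurableSet (C n (st n).2) := fun n =>
    measurableSet_lt measurable_const (((hm n).2 n).const_mul 2)
  have hs := fun n => hstep (D n) _ (hm n).1 (hC n)
  refine ⟨D, ψ, ⟨rfl, fun n => (hm n).1, fun n => (hs n).1.1, fun n => (hs n).1.2.2.1,
    fun n => (hs n).2.1, fun n => (hs n).2.2.1, fun n => (hs n).2.2.2.1, ?_,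
    fun n => (hs n).2.2.2.2.2.1, fun n => (hs n).2.2.2.2.2.2⟩, ?_⟩
  · intro n x hx
    exact (hs n).2.2.2.2.1 x (fun h => hx ((hs n).1.1 h)) fun h => hx h.1
  · intro n
    have hCn : C n (st n).2 = {x | 2 ^ n < 2 * sumAlong ψ ((B n).indicator 1) n x} := by
      simp only [C, hR]
    rw [← hCn]
    exact (hs n).1.2.2.2

variable [StandardBorelSpace Ω]

open scoped symmDiff in
/-- An invariant set that is close to `B n` is nearly null or nearly conull. -/
theorem IsTower.measure_le [IsProbabilityMeasure ν] {T : Ω → Ω → Prop}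
    (hT : IsErgodicSubrelation Γ ν T) {D : ℕ → Set Ω} {ψ : ℕ → Ω → Ω} (h : IsTower ν T D ψ)
    {B : Set Ω} (hB : MeasurableSet B) {n : ℕ}
    (hn : Disjoint (D (n + 1)) {x | 2 ^ n < 2 * sumAlong ψ (B.indicator 1) n x} ∨
        D n \ D (n + 1) ⊆ {x | 2 ^ n < 2 * sumAlong ψ (B.indicator 1) n x})
    {A : Set Ω} (hAm : MeasurableSet A) (hA : ∀ n, ∀ x ∈ D (n + 1), x ∈ A ↔ ψ n x ∈ A) :
    ν A ≤ 4 * ν (A ∆ B) ∨ ν Aᶜ ≤ 4 * ν (A ∆ B) := by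
  set F := sumAlong ψ (B.indicator 1) n
  set G := sumAlong ψ ((A ∆ B).indicator 1) n
  set C : Set Ω := {x | 2 ^ n < 2 * F x}
  have hAc : ∀ n, ∀ x ∈ D (n + 1), x ∈ Aᶜ ↔ ψ n x ∈ Aᶜ := fun n x hx => not_congr (hA n x hx)
  have hsd : MeasurableSet (A ∆ B) := hAm.symmDiff hB
  have hGm : Measurable G := h.measurable_sumAlong (measurable_one.indicator hsd) n
  have h1 : ∀ x ∈ D n, x ∈ A → F x + G x = 2 ^ n := by
    intro x hx hxA
    have := h.sumAlong_congr hA (u := B.indicator 1 + (A ∆ B).indicator 1) (v := fun _ => 1) (by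
      intro y hy
      by_cases hyB : y ∈ B <;> simp [mem_symmDiff, hy, hyB]) n x hx hxA
    rwa [sumAlong_add, sumAlong_const, mul_one] at this
  have h2 : ∀ x ∈ D n, x ∉ A → F x = G x := by
    intro x hx hxA
    refine h.sumAlong_congr hAc ?_ n x hx hxA
    intro y hy
    have hy' : y ∉ A := hy
    by_cases hyB : y ∈ B <;> simp [mem_symmDiff, hy', hyB]
  have hmarkov : 2 ^ n * ν ({x | 2 ^ n ≤ 2 * G x} ∩ D n) ≤ 2 * ν (A ∆ B) := by
    have h3 := mul_meas_ge_le_lintegral (μ := ν.restrict (D n)) (hGm.const_mul 2) (2 ^ n)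
    rw [lintegral_const_mul _ hGm, h.lintegral_sumAlong hT (measurable_one.indicator hsd),
      lintegral_indicator_one hsd, Measure.restrict_apply
        (measurableSet_le measurable_const (hGm.const_mul 2))] at h3
    exact h3
  have hfin : ∀ {S : Set Ω} {c : ENNReal}, S ⊆ {x | 2 ^ n ≤ 2 * G x} ∩ D n →
      2 ^ (n + 1) * ν S = c → c ≤ 4 * ν (A ∆ B) := by
    rintro S c hS rfl
    calc 2 ^ (n + 1) * ν S ≤ 2 ^ (n + 1) * ν ({x | 2 ^ n ≤ 2 * G x} ∩ D n) := by gcongr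
      _ = 2 * (2 ^ n * ν ({x | 2 ^ n ≤ 2 * G x} ∩ D n)) := by rw [pow_succ]; ring
      _ ≤ 2 * (2 * ν (A ∆ B)) := by gcongr
      _ = 4 * ν (A ∆ B) := by rw [← mul_assoc]; norm_num
  rcases hn with hn | hn
  · left
    refine hfin (S := A ∩ D (n + 1)) ?_ (h.measure_inter hT hAm hA (n + 1)).1
    rintro x ⟨hxA, hxD⟩
    refine ⟨?_, h.anti n hxD⟩
    have hC : ¬ 2 ^ n < 2 * F x := Set.disjoint_left.1 hn hxD
    have h4 := h1 x (h.anti n hxD) hxA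
    change 2 ^ n ≤ 2 * G x
    by_contra h5
    have h6 : 2 * F x + 2 * G x = 2 ^ n + 2 ^ n := by rw [← mul_add, h4, two_mul]
    have h7 := ENNReal.add_lt_add_of_le_of_lt (a := 2 * F x) (b := 2 ^ n) (c := 2 * G x) (d := 2 ^ n)
      (ne_top_of_le_ne_top (by finiteness) (not_lt.1 hC)) (not_lt.1 hC) (not_le.1 h5)
    rw [h6] at h7
    exact lt_irrefl _ h7
  · right
    refine hfin (S := Aᶜ ∩ (D n \ D (n + 1))) ?_ (h.measure_inter hT hAm.compl hAc n).2
    rintro x ⟨hxA, hxD⟩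
    refine ⟨?_, hxD.1⟩
    have hC : 2 ^ n < 2 * F x := hn hxD
    rw [h2 x hxD.1 hxA] at hC
    exact hC.le

open scoped symmDiff in
/-- The full group of an ergodic relation contains an ergodic transformation. -/
theorem IsErgodicSubrelation.exists_ergodic [IsProbabilityMeasure ν] {T : Ω → Ω → Prop}
    (hT : IsErgodicSubrelation Γ ν T)
    (hna : ∀ E : Set Ω, MeasurableSet E → ∀ c ≤ ν E, ∃ E' ⊆ E, MeasurableSet E' ∧ ν E' = c)
    {B : ℕ → Set Ω} (hB : ∀ j, MeasurableSet (B j))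
    (hdense : ∀ A, MeasurableSet A → ∀ ε : ENNReal, 0 < ε → ∃ j, ν (A ∆ B j) ≤ ε) :
    ∃ F : Ω ≃ Ω, Measurable F ∧ Measurable F.symm ∧ (∀ x, T x (F x)) ∧
      ∀ A, MeasurableSet A → (∀ x, x ∈ A ↔ F x ∈ A) → ν A = 0 ∨ ν Aᶜ = 0 := by
  classical
  have hne : Nonempty Ω := nonempty_of_isProbabilityMeasure ν
  obtain ⟨D, ψ, h, hD⟩ := exists_tower hT hna hB
  let E : ℕ → Set Ω := fun n => (compUp ψ n) ⁻¹' (D n)ᶜ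
  have hE : ∀ n, MeasurableSet (E n) := fun n => h.measurable_compUp n (h.measurableSet n).compl
  have hE_eq : ∀ n m x, x ∈ E n → x ∈ E m → compUp ψ n x = compUp ψ m x := by
    intro n m x hn hm
    rcases le_total n m with hnm | hnm
    · exact (h.compUp_stable hnm hn).symm
    · exact h.compUp_stable hnm hm
  obtain ⟨a, ham, ha⟩ := exists_measurable_piecewise E hE (fun n => compUp ψ n)
    (fun n => h.measurable_compUp n) fun n m _ x hx => hE_eq n m x hx.1 hx.2
  have hmem : ∀ {n m x}, n ≤ m → x ∈ E n → x ∈ E m := by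
    intro n m x hnm hx
    change compUp ψ m x ∉ D m
    rw [h.compUp_stable hnm hx]
    exact fun h' => hx (h.antitone hnm h')
  have hmp : ∀ n, MeasurePreserving (compUp ψ n) ν ν := by
    intro n
    induction n with
    | zero => exact MeasurePreserving.id ν
    | succ n ih => exact (h.measurePreserving hT n).comp ih
  have hS0 : ν (⋃ n, E n)ᶜ = 0 := by
    have h1 : ∀ n : ℕ, ν (⋃ n, E n)ᶜ ≤ 2⁻¹ ^ n := by
      intro n
      have h2 : (⋃ n, E n)ᶜ ⊆ compUp ψ n ⁻¹' (D n) := by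
        intro x hx
        by_contra h'
        exact hx (mem_iUnion.2 ⟨n, h'⟩)
      refine (measure_mono h2).trans ?_
      rw [(hmp n).measure_preimage (h.measurableSet n).nullMeasurableSet, ← ENNReal.inv_pow]
      exact (ENNReal.eq_inv_of_mul_eq_one_left (h.measure_D n)).le
    refine le_antisymm (ge_of_tendsto' (ENNReal.tendsto_pow_atTop_nhds_zero_of_lt_one ?_) h1)
      zero_le
    exact ENNReal.inv_lt_one.2 (by norm_num)
  have haT : ∀ n, ∀ x ∈ E n, T x (a x) := by
    intro n x hx
    rw [ha n hx]
    exact h.related_compUp hT.equivalence n x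
  obtain ⟨F, Y, hFm, hFm', hY, hYS, hY0, hYinv, hFY, hFY'⟩ :=
    exists_completion (Γ := Γ) (ν := ν) ham (MeasurableSet.iUnion hE) hS0 (by
      intro x hx y hy hxy
      obtain ⟨n, hn⟩ := mem_iUnion.1 hx
      obtain ⟨m, hm⟩ := mem_iUnion.1 hy
      have hn' := hmem (le_max_left n m) hn
      have hm' := hmem (le_max_right n m) hm
      rw [ha _ hn', ha _ hm'] at hxy
      rw [← h.compDown_compUp (max n m) x, hxy, h.compDown_compUp]) (by
      intro x hx
      obtain ⟨n, hn⟩ := mem_iUnion.1 hx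
      exact hT.orbit _ _ (haT n x hn))
  have hFT : ∀ x, T x (F x) := by
    intro x
    by_cases hx : x ∈ Y
    · obtain ⟨n, hn⟩ := mem_iUnion.1 (hYS hx)
      rw [hFY x hx]
      exact haT n x hn
    · rw [hFY' x hx]
      exact hT.equivalence.refl x
  refine ⟨F, hFm, hFm', hFT, fun A hA hAF => ?_⟩
  have hAY : ∀ n y, compUp ψ n y ∉ D n → (y ∈ A ∩ Y ↔ compUp ψ n y ∈ A ∩ Y) := by
    intro n y hy
    obtain ⟨g, hg⟩ := hT.orbit _ _ (h.related_compUp hT.equivalence n y)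
    by_cases hyY : y ∈ Y
    · have h1 : F y = compUp ψ n y := (hFY y hyY).trans (ha n hy)
      have h2 : compUp ψ n y ∈ Y := hg ▸ hYinv g y hyY
      rw [mem_inter_iff, mem_inter_iff, hAF y, h1]
      simp only [hyY, h2]
    · have h2 : compUp ψ n y ∉ Y := by
        intro h3
        rw [hg] at h3
        have := hYinv g⁻¹ _ h3
        rw [inv_smul_smul] at this
        exact hyY this
      simp only [mem_inter_iff, hyY, h2, and_false]
  have hAψ := fun n => (h.mem_iff hAY n).2
  have hA' : MeasurableSet (A ∩ Y) := hA.inter hY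
  have hν : ν (A ∩ Y) = ν A := by
    rw [← measure_inter_add_sdiff A hY, 
      measure_mono_null (s := A \ Y) (fun x hx => hx.2) hY0, add_zero]
  have hν' : ν (A ∩ Y)ᶜ = ν Aᶜ := by
    rw [measure_compl hA' (measure_ne_top _ _), measure_compl hA (measure_ne_top _ _), hν]
  have key : ∀ ε : ENNReal, 0 < ε → min (ν A) (ν Aᶜ) ≤ ε := by
    intro ε hε
    obtain ⟨j, hj⟩ := hdense _ hA' (ε / 4) (ENNReal.div_pos hε.ne' (by norm_num))
    have h4 : 4 * ν ((A ∩ Y) ∆ B j) ≤ ε := by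
      calc 4 * ν ((A ∩ Y) ∆ B j) ≤ 4 * (ε / 4) := by gcongr
        _ = ε := ENNReal.mul_div_cancel (by norm_num) (by norm_num)
    rcases h.measure_le hT (hB j) (hD j) hA' hAψ with h5 | h5
    · rw [hν] at h5
      exact (min_le_left _ _).trans (h5.trans h4)
    · rw [hν'] at h5
      exact (min_le_right _ _).trans (h5.trans h4)
  have h0 : min (ν A) (ν Aᶜ) = 0 := by
    by_contra hne0
    have hpos := pos_iff_ne_zero.2 hne0
    have hlt := ENNReal.half_lt_self hne0 (ne_top_of_le_ne_top (measure_ne_top ν A) (min_le_left _ _))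
    exact absurd (key _ (ENNReal.half_pos hne0)) (not_le.2 hlt)
  rcases min_eq_iff.1 h0 with h1 | h1
  · exact Or.inl h1.1
  · exact Or.inr h1.1

end Tower

section Bridges

variable {Γ Ω : Type*} [Group Γ] [Countable Γ] [MeasurableSpace Ω]
  [MulAction Γ Ω] [MeasurableConstSMul Γ Ω] {ν : Measure Ω} [SMulInvariantMeasure Γ Ω ν]
  [StandardBorelSpace Ω]

/-- A transformation each of whose displacements runs along its own bridge, up to moves inside
the classes of `T`. -/
theorem IsErgodicSubrelation.exists_bridging [IsProbabilityMeasure ν] {T : Ω → Ω → Prop}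
    (hT : IsErgodicSubrelation Γ ν T) {V : Bool → Set Ω} (hV : ∀ t, MeasurableSet (V t))
    {φ : Bool → Ω → Γ} (hφ : ∀ t γ, MeasurableSet {x | φ t x = γ})
    (hlarge : 1 < ν (V true) + ν (V false)) :
    ∃ (b : Ω ≃ Ω) (Y : Set Ω) (β : Ω → Bool × Ω), Measurable b ∧ Measurable b.symm ∧
      MeasurableSet Y ∧ ν Yᶜ = 0 ∧ (∀ (g : Γ) (x : Ω), x ∈ Y → g • x ∈ Y) ∧
      (∀ x, ∃ g : Γ, b x = g • x) ∧ InjOn β Y ∧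
      ∀ x ∈ Y, (β x).2 ∈ V (β x).1 ∧ T x (β x).2 ∧ T (φ (β x).1 (β x).2 • (β x).2) (b x) := by
  classical
  have hne : Nonempty Ω := nonempty_of_isProbabilityMeasure ν
  obtain ⟨p, hp⟩ := exists_surjective_nat (Γ × Bool × Γ × Γ)
  let g : ℕ → Γ := fun i => (p i).1
  let t : ℕ → Bool := fun i => (p i).2.1
  let c : ℕ → Γ := fun i => (p i).2.2.1
  let h : ℕ → Γ := fun i => (p i).2.2.2
  let u : ℕ → Γ := fun i => h i * (c i * g i)
  let M : ℕ → Set Ω := fun i => {x | T x (g i • x)} ∩ ((fun x => g i • x) ⁻¹'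
    (V (t i) ∩ {y | φ (t i) y = c i})) ∩ (fun x => (c i * g i) • x) ⁻¹' {y | T y (h i • y)}
  let conf : ℕ → ℕ → Set Ω → Set Ω := fun i j E => E ∪ (fun x => u i • x) ⁻¹' (u j • E) ∪
    if t i = t j then (fun x => g i • x) ⁻¹' (g j • E) else ∅
  have hM : ∀ i, MeasurableSet (M i) := fun i =>
    ((hT.measurableSet_smul _).inter (measurable_const_smul (g i) ((hV _).inter (hφ _ _)))).inter
      (measurable_const_smul (c i * g i) (hT.measurableSet_smul _))
  have hc : ∀ i j E, MeasurableSet E → MeasurableSet (conf i j E) := by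
    intro i j E hE
    refine (hE.union (measurable_const_smul (u i) (hE.const_smul (u j)))).union ?_
    split_ifs
    · exact measurable_const_smul (g i) (hE.const_smul (g j))
    · exact MeasurableSet.empty
  set E := greedy M conf with hEdef
  have hEm : ∀ i, MeasurableSet (E i) := measurableSet_greedy hM hc
  have hEM : ∀ i x, x ∈ E i → x ∈ M i := fun i x hx => (mem_greedy.1 hx).1
  have hd1 : ∀ i j x, x ∈ E i → x ∈ E j → i = j := by
    intro i j x hi hj
    rcases lt_trichotomy i j with h | h | h
    · exact absurd (Or.inl (Or.inl hi)) ((mem_greedy.1 hj).2 i h)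
    · exact h
    · exact absurd (Or.inl (Or.inl hj)) ((mem_greedy.1 hi).2 j h)
  have hd2 : ∀ i j x y, x ∈ E i → y ∈ E j → u i • x = u j • y → i = j := by
    intro i j x y hi hj hxy
    rcases lt_trichotomy i j with h | h | h
    · exact absurd (Or.inl (Or.inr ⟨x, hi, hxy⟩)) ((mem_greedy.1 hj).2 i h)
    · exact h
    · exact absurd (Or.inl (Or.inr ⟨y, hj, hxy.symm⟩)) ((mem_greedy.1 hi).2 j h)
  have hd3 : ∀ i j x y, x ∈ E i → y ∈ E j → t i = t j → g i • x = g j • y → i = j := by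
    intro i j x y hi hj ht hxy
    rcases lt_trichotomy i j with h | h | h
    · refine absurd (Or.inr ?_) ((mem_greedy.1 hj).2 i h)
      rw [if_pos ht.symm]
      exact ⟨x, hi, hxy⟩
    · exact h
    · refine absurd (Or.inr ?_) ((mem_greedy.1 hi).2 j h)
      rw [if_pos ht]
      exact ⟨y, hj, hxy.symm⟩
  obtain ⟨f, hfm, hf, -⟩ := exists_glue hEm hd1 (f := fun i x => u i • x)
    fun i => measurable_const_smul (u i)
  have hfinj : InjOn f (⋃ i, E i) := by
    intro x hx y hy hxy
    obtain ⟨i, hi⟩ := mem_iUnion.1 hx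
    obtain ⟨j, hj⟩ := mem_iUnion.1 hy
    rw [hf i x hi, hf j y hj] at hxy
    obtain rfl := hd2 i j x y hi hj hxy
    exact smul_left_cancel _ hxy
  have hfimg : f '' (⋃ i, E i) = ⋃ i, u i • E i := by
    rw [image_iUnion]
    exact iUnion_congr fun i => image_congr fun x hx => hf i x hx
  have hforb : ∀ x ∈ ⋃ i, E i, ∃ g : Γ, f x = g • x := by
    intro x hx
    obtain ⟨i, hi⟩ := mem_iUnion.1 hx
    exact ⟨_, hf i x hi⟩
  have hU : MeasurableSet (⋃ i, E i) := MeasurableSet.iUnion hEm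
  have hU' : MeasurableSet (⋃ i, u i • E i) :=
    MeasurableSet.iUnion fun i => (hEm i).const_smul (u i)
  let Z : Bool → Set Ω := fun s => ⋃ i, if t i = s then g i • E i else ∅
  have hZi : ∀ s i, MeasurableSet (if t i = s then g i • E i else ∅) := by
    intro s i
    split_ifs
    · exact (hEm i).const_smul (g i)
    · exact MeasurableSet.empty
  have hZm : ∀ s, MeasurableSet (Z s) := fun s => MeasurableSet.iUnion (hZi s)
  have hZν : ∀ s, ν (Z s) = ∑' i, if t i = s then ν (E i) else 0 := by
    intro s
    rw [measure_iUnion _ (hZi s)]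
    · refine tsum_congr fun i => ?_
      split_ifs
      · exact measure_smul ν (g i) _
      · exact measure_empty
    · intro i j hij
      refine Set.disjoint_left.2 fun x hx hy => ?_
      by_cases hi : t i = s
      · by_cases hj : t j = s
        · simp only [hi, hj, if_true] at hx hy
          obtain ⟨x, hx, rfl⟩ := hx
          obtain ⟨y, hy, hxy⟩ := hy
          exact hij (hd3 i j x y hx hy (hi.trans hj.symm) hxy.symm)
        · simp [hj] at hy
      · simp [hi] at hx
  have hZsum : ν (Z true) + ν (Z false) ≤ 1 := by
    rw [hZν, hZν, ← ENNReal.tsum_add]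
    calc ∑' i, ((if t i = true then ν (E i) else 0) + if t i = false then ν (E i) else 0)
        = ∑' i, ν (E i) := tsum_congr fun i => by cases t i <;> simp
      _ = ν (⋃ i, E i) := (measure_iUnion (fun i j hij => Set.disjoint_left.2
          fun x hx hy => hij (hd1 i j x hx hy)) hEm).symm
      _ ≤ 1 := prob_le_one
  obtain ⟨s, hs⟩ : ∃ s, ν (V s \ Z s) ≠ 0 := by
    by_contra! hcon
    have hle : ∀ s, ν (V s) ≤ ν (Z s) := by
      intro s
      calc ν (V s) ≤ ν (V s \ Z s) + ν (Z s) := by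
            refine (measure_mono ?_).trans (measure_union_le _ _)
            intro x hx
            by_cases hxZ : x ∈ Z s
            · exact Or.inr hxZ
            · exact Or.inl ⟨hx, hxZ⟩
        _ = ν (Z s) := by rw [hcon, zero_add]
    exact absurd (hlarge.trans_le (add_le_add (hle _) (hle _))) (not_lt.2 hZsum)
  obtain ⟨γ, hγ⟩ : ∃ γ, ν ((V s \ Z s) ∩ {x | φ s x = γ}) ≠ 0 := by
    by_contra! hcon
    refine hs (measure_mono_null ?_ (measure_iUnion_null hcon))
    intro x hx
    exact mem_iUnion.2 ⟨φ s x, hx, rfl⟩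
  have hS0 : ν (⋃ i, E i)ᶜ = 0 := by
    by_contra hpos
    have hpos' : ν (⋃ i, u i • E i)ᶜ ≠ 0 := by
      rwa [measure_compl hU' (measure_ne_top _ _), ← hfimg,
        measure_image_of_orbit hfm hU hfinj hforb, ← measure_compl hU (measure_ne_top _ _)]
    have h1 := hT.saturation hU.compl hpos
    have h2 := hT.saturation hU'.compl hpos'
    have h3 : ν ((fun x => γ • x) ⁻¹' {x | ∃ y ∈ (⋃ i, u i • E i)ᶜ, T x y}ᶜ) = 0 := by
      rw [measure_preimage_smul, h2]
    have h4 : ∃ v ∈ (V s \ Z s) ∩ {x | φ s x = γ}, (∃ x ∈ (⋃ i, E i)ᶜ, T v x) ∧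
        ∃ y ∈ (⋃ i, u i • E i)ᶜ, T (γ • v) y := by
      by_contra! hcon
      refine hγ (measure_mono_null ?_ (measure_union_null h1 h3))
      intro v hv
      by_cases hv1 : ∃ x ∈ (⋃ i, E i)ᶜ, T v x
      · right
        rintro ⟨y, hy, hvy⟩
        exact hcon v hv hv1 y hy hvy
      · exact Or.inl hv1
    obtain ⟨v, ⟨⟨hvV, hvZ⟩, hvγ⟩, ⟨x, hx, hvx⟩, y, hy, hvy⟩ := h4
    obtain ⟨k, hk⟩ := hT.orbit _ _ (hT.equivalence.symm hvx)
    obtain ⟨l, rfl⟩ := hT.orbit _ _ hvy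
    subst hk
    obtain ⟨i, hi⟩ := hp (k, s, γ, l)
    have hgi : g i = k := by simp only [g, hi]
    have hti : t i = s := by simp only [t, hi]
    have hci : c i = γ := by simp only [c, hi]
    have hhi : h i = l := by simp only [h, hi]
    apply hx
    refine mem_iUnion.2 ⟨i, mem_greedy.2 ⟨⟨⟨?_, ?_, ?_⟩, ?_⟩, ?_⟩⟩
    · rw [hgi]
      exact hT.equivalence.symm hvx
    · rw [hgi, hti]
      exact hvV
    · rw [hgi, hti, hci]
      exact hvγ
    · rw [hci, hgi, hhi]
      change T ((γ * k) • x) (l • (γ * k) • x)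
      rw [mul_smul]
      exact hvy
    · rintro j hj ((h5 | h5) | h5)
      · exact hx (mem_iUnion.2 ⟨j, h5⟩)
      · refine hy (mem_iUnion.2 ⟨j, ?_⟩)
        simp only [mem_preimage, u, hgi, hci, hhi, mul_smul] at h5
        simpa only [u, mul_smul] using h5
      · by_cases hij : t i = t j
        · rw [if_pos hij] at h5
          refine hvZ (mem_iUnion.2 ⟨j, ?_⟩)
          rw [if_pos (hij.symm.trans hti), ← hgi]
          exact h5
        · rw [if_neg hij] at h5
          exact h5
  obtain ⟨b, Y, hbm, hbm', hY, hYS, hY0, hYinv, hbY, hbY'⟩ :=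
    exists_completion (Γ := Γ) (ν := ν) hfm hU hS0 hfinj hforb
  have hidx : ∀ x, ∃ i, x ∈ Y → x ∈ E i := by
    intro x
    by_cases hx : x ∈ Y
    · obtain ⟨i, hi⟩ := mem_iUnion.1 (hYS hx)
      exact ⟨i, fun _ => hi⟩
    · exact ⟨0, fun h' => absurd h' hx⟩
  choose idx hidx using hidx
  refine ⟨b, Y, fun x => (t (idx x), g (idx x) • x), hbm, hbm', hY, hY0, hYinv, ?_, ?_, ?_⟩
  · intro x
    by_cases hx : x ∈ Y
    · rw [hbY x hx]
      exact hforb x (hYS hx)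
    · exact ⟨1, by rw [hbY' x hx, one_smul]⟩
  · intro x hx y hy hxy
    obtain ⟨h1, h2⟩ := Prod.mk.inj hxy
    have h3 := hd3 _ _ x y (hidx x hx) (hidx y hy) h1 h2
    rw [h3] at h2
    exact smul_left_cancel _ h2
  · intro x hx
    have h1 := hEM _ x (hidx x hx)
    refine ⟨h1.1.2.1, h1.1.1, ?_⟩
    have h2 : φ (t (idx x)) (g (idx x) • x) = c (idx x) := h1.1.2.2
    have h3 : T ((c (idx x) * g (idx x)) • x) (h (idx x) • (c (idx x) * g (idx x)) • x) := h1.2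
    rw [hbY x hx, hf _ x (hidx x hx)]
    change T (φ (t (idx x)) (g (idx x) • x) • g (idx x) • x) ((h _ * (c _ * g _)) • x)
    rw [h2, mul_smul, smul_smul]
    exact h3

end Bridges

section Words

variable {Ω : Type*}

theorem perm_apply_inv_self (f : Equiv.Perm Ω) (x : Ω) : f (f⁻¹ x) = x := f.apply_symm_apply x

/-- The permutation given by a word in the letters `a`, `b` and their inverses. -/
def evalWord (a b : Equiv.Perm Ω) (L : List (Fin 2 × Bool)) : Equiv.Perm Ω :=
  (L.map fun p => cond p.2 (![a, b] p.1) (![a, b] p.1)⁻¹).prod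

theorem evalWord_cons (a b : Equiv.Perm Ω) (p : Fin 2 × Bool) (L : List (Fin 2 × Bool)) (x : Ω) :
    evalWord a b (p :: L) x = (cond p.2 (![a, b] p.1) (![a, b] p.1)⁻¹) (evalWord a b L x) := rfl

theorem evalWord_append (a b : Equiv.Perm Ω) (K L : List (Fin 2 × Bool)) (x : Ω) :
    evalWord a b (K ++ L) x = evalWord a b K (evalWord a b L x) := by
  simp [evalWord]

/-- A reduced word in the single letter `a` is a power of `a`. -/
theorem evalWord_eq_zpow (a b : Equiv.Perm Ω) (K : List (Fin 2 × Bool)) (s : Bool)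
    (hr : FreeGroup.IsReduced ((0, s) :: K)) (h0 : ∀ p ∈ K, p.1 = 0) :
    evalWord a b ((0, s) :: K) = (cond s a a⁻¹) ^ (K.length + 1) := by
  induction K generalizing s with
  | nil => cases s <;> simp [evalWord]
  | cons q K ih =>
    obtain ⟨i, s'⟩ := q
    obtain rfl : i = 0 := h0 (i, s') (by simp)
    have hr' := hr
    rw [FreeGroup.IsReduced, List.isChain_cons_cons] at hr'
    obtain rfl : s = s' := hr'.1 rfl
    have h1 := ih s hr'.2 fun p hp => h0 p (List.mem_cons_of_mem _ hp)
    have h2 : evalWord a b ((0, s) :: (0, s) :: K) = cond s a a⁻¹ * evalWord a b ((0, s) :: K) := by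
      cases s <;> simp [evalWord]
    rw [h2, h1, List.length_cons, ← pow_succ']

/-- Words fixing no class of `T`: the algebraic core of the freeness argument. -/
theorem not_related_evalWord {T : Ω → Ω → Prop} (hT : Equivalence T) {a b : Equiv.Perm Ω}
    {Y : Set Ω} (ha : ∀ x, a x ∈ Y ↔ x ∈ Y) (hb : ∀ x, b x ∈ Y ↔ x ∈ Y)
    (haT : ∀ x, T x (a x)) (hper : ∀ x ∈ Y, ∀ n : ℕ, (a ^ (n + 1)) x ≠ x)
    {β : Ω → Bool × Ω} {r : Bool × Ω → Ω} {S : Set (Bool × Ω)} (hβ : InjOn β Y)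
    (hS : ∀ x ∈ Y, β x ∈ S) (hβ1 : ∀ x ∈ Y, T x (β x).2) (hβ2 : ∀ x ∈ Y, T (r (β x)) (b x))
    (hbridge : ∀ e ∈ S, ¬ Relation.EqvGen
      (fun x y => T x y ∨ ∃ e' ∈ S, e' ≠ e ∧ x = e'.2 ∧ y = r e') e.2 (r e))
    (L : List (Fin 2 × Bool)) (hr : FreeGroup.IsReduced L) :
    (∃ p ∈ L, p.1 = 1) → ∀ x ∈ Y, ¬ T x (evalWord a b L x) := by
  have ha' : ∀ x, a⁻¹ x ∈ Y ↔ x ∈ Y := fun x => by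
    rw [← ha (a⁻¹ x), perm_apply_inv_self]
  have hb' : ∀ x, b⁻¹ x ∈ Y ↔ x ∈ Y := fun x => by
    rw [← hb (b⁻¹ x), perm_apply_inv_self]
  have hYw : ∀ (L : List (Fin 2 × Bool)) (x : Ω), x ∈ Y → evalWord a b L x ∈ Y := by
    intro L x hx
    induction L with
    | nil => exact hx
    | cons p L ih =>
      rw [evalWord_cons]
      obtain ⟨i, s⟩ := p
      fin_cases i <;> cases s
      · exact (ha' _).2 ih
      · exact (ha _).2 ih
      · exact (hb' _).2 ih
      · exact (hb _).2 ih
  have haT' : ∀ x, T x (a⁻¹ x) := fun x => by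
    have := hT.symm (haT (a⁻¹ x))
    rwa [perm_apply_inv_self] at this
  have hper' : ∀ K : List (Fin 2 × Bool), FreeGroup.IsReduced K → K ≠ [] → (∀ p ∈ K, p.1 ≠ 1) →
      ∀ x ∈ Y, evalWord a b K x ≠ x := by
    intro K hK hne h1 x hx
    have h0 : ∀ p ∈ K, p.1 = 0 := fun p hp => by
      have := h1 p hp
      omega
    cases K with
    | nil => exact absurd rfl hne
    | cons p K =>
      obtain ⟨i, s⟩ := p
      obtain rfl : i = 0 := h0 (i, s) (by simp)
      rw [evalWord_eq_zpow a b K s hK fun p hp => h0 p (List.mem_cons_of_mem _ hp)]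
      cases s
      · intro h
        simp only [cond_false, inv_pow] at h
        rw [Equiv.Perm.inv_eq_iff_eq] at h
        exact hper x hx _ h.symm
      · exact hper x hx _
  let base : Bool → Ω → Ω := fun s y => cond s y (b⁻¹ y)
  have hbaseY : ∀ s y, y ∈ Y → base s y ∈ Y := by
    intro s y hy
    cases s
    · exact (hb' y).2 hy
    · exact hy
  induction hn : L.length using Nat.strong_induction_on generalizing L with
  | _ n ih =>
  intro hL x hx hTx
  cases L with
  | nil => simp at hL
  | cons p L =>
    obtain ⟨i, s⟩ := p
    have hrL : FreeGroup.IsReduced L := List.IsChain.right_of_append (l₁ := [(i, s)]) hr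
    have hn' : L.length + 1 = n := by simpa using hn
    by_cases hi : i = 0
    · subst hi
      have hL' : ∃ p ∈ L, p.1 = 1 := by
        obtain ⟨p, hp, hp1⟩ := hL
        rcases List.mem_cons.1 hp with rfl | hp
        · simp at hp1
        · exact ⟨p, hp, hp1⟩
      refine ih L.length (by omega) L hrL rfl hL' x hx (hT.trans hTx (hT.symm ?_))
      rw [evalWord_cons]
      cases s
      · exact haT' _
      · exact haT _
    obtain rfl : i = 1 := by omega
    set y := evalWord a b L x with hy
    have hyY : y ∈ Y := hYw L x hx
    set e := β (base s y) with he
    have heS : e ∈ S := hS _ (hbaseY s y hyY)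
    let Link : Ω → Ω → Prop := fun x y => T x y ∨ ∃ e' ∈ S, e' ≠ e ∧ x = e'.2 ∧ y = r e'
    have hl : ∀ {x y}, T x y → Relation.EqvGen Link x y := fun h =>
      Relation.EqvGen.rel _ _ (Or.inl h)
    by_cases huse : ∃ K M s', L = K ++ (1, s') :: M ∧ β (base s' (evalWord a b M x)) = e
    · obtain ⟨K, M, s', hKM, hbe⟩ := huse
      set m := evalWord a b M x with hm
      have hmY : m ∈ Y := hYw M x hx
      have hbase : base s' m = base s y := hβ (hbaseY _ _ hmY) (hbaseY _ _ hyY) hbe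
      have hlen : L.length = K.length + (M.length + 1) := by
        rw [hKM, List.length_append, List.length_cons]
      have hyK : y = evalWord a b K (evalWord a b [(1, s')] m) := by
        rw [hy, hKM, evalWord_append]
        rfl
      by_cases hss : s' = s
      · subst hss
        have hmy : m = y := by
          cases s'
          · exact b⁻¹.injective hbase
          · exact hbase
        have hred : FreeGroup.IsReduced (K ++ [(1, s')]) :=
          List.IsChain.left_of_append (l₂ := M) (
            List.IsChain.right_of_append (l₁ := [(1, s')])
              (by simpa [hKM, FreeGroup.IsReduced] using hr))
        refine ih _ ?_ _ hred rfl ⟨(1, s'), by simp, rfl⟩ m hmY ?_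
        · rw [List.length_append, List.length_singleton]
          omega
        · rw [evalWord_append, ← hyK, ← hmy]
          exact hT.refl m
      · have hmy : evalWord a b [(1, s')] m = y := by
          cases s' <;> cases s
          · exact absurd rfl hss
          · exact hbase
          · change b m = y
            have h1 : m = b⁻¹ y := hbase
            rw [h1, perm_apply_inv_self]
          · exact absurd rfl hss
        rw [hmy] at hyK
        have hKne : K ≠ [] := by
          rintro rfl
          rw [hKM, List.nil_append, FreeGroup.IsReduced, List.isChain_cons_cons] at hr
          exact hss (hr.1 rfl).symm
        have hKred : FreeGroup.IsReduced K := List.IsChain.left_of_append (hKM ▸ hrL)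
        by_cases hKb : ∃ p ∈ K, p.1 = 1
        · refine ih K.length (by omega) K hKred rfl hKb y hyY ?_
          rw [← hyK]
          exact hT.refl y
        · push Not at hKb
          exact hper' K hKred hKne hKb y hyY hyK.symm
    · have hconn : Relation.EqvGen Link x y := by
        rw [hy]
        clear_value y e
        clear hy hTx hr hrL hn hn' hL he
        induction L with
        | nil => exact Relation.EqvGen.refl _
        | cons p L ihL =>
          have h1 := ihL (by
            rintro ⟨K, M, s', hKM, h⟩
            exact huse ⟨p :: K, M, s', by rw [hKM]; rfl, h⟩)
          refine h1.trans _ _ _ ?_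
          rw [evalWord_cons]
          set z := evalWord a b L x with hz
          have hzY : z ∈ Y := hYw L x hx
          obtain ⟨i, s'⟩ := p
          by_cases hi : i = 0
          · subst hi
            cases s'
            · exact hl (haT' _)
            · exact hl (haT _)
          obtain rfl : i = 1 := by omega
          have hne : β (base s' z) ≠ e := fun h => huse ⟨[], L, s', rfl, h⟩
          have hqY := hbaseY s' z hzY
          have h2 : Relation.EqvGen Link (base s' z) (b (base s' z)) :=
            ((hl (hβ1 _ hqY)).trans _ _ _
              (Relation.EqvGen.rel _ (r (β (base s' z)))
                (Or.inr ⟨_, hS _ hqY, hne, rfl, rfl⟩))).trans _ _ _ (hl (hβ2 _ hqY))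
          cases s'
          · refine Relation.EqvGen.symm _ _ ?_
            have h3 : b (base false z) = z := perm_apply_inv_self _ _
            rw [h3] at h2
            exact h2
          · exact h2
      have hqY := hbaseY s y hyY
      have hyw : Relation.EqvGen Link y (evalWord a b ((1, s) :: L) x) :=
        (hconn.symm _ _).trans _ _ _ (hl hTx)
      have hqb : Relation.EqvGen Link (base s y) (b (base s y)) := by
        rw [evalWord_cons, ← hy] at hyw
        cases s
        · have h3 : b (base false y) = y := perm_apply_inv_self _ _
          rw [h3]
          exact hyw.symm _ _
        · exact hyw
      refine hbridge e heS ?_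
      exact (((hl (hβ1 _ hqY)).symm _ _).trans _ _ _ hqb).trans _ _ _ ((hl (hβ2 _ hqY)).symm _ _)

end Words

section Abstract

variable {Γ Ω : Type*} [Group Γ] [MeasurableSpace Ω] [MulAction Γ Ω] {ν : Measure Ω}

variable (Γ) in
/-- Bimeasurable permutations moving points inside `Γ`-orbits. -/
def IsFull (F : Equiv.Perm Ω) : Prop :=
  Measurable F ∧ Measurable F.symm ∧ ∀ x, ∃ g : Γ, F x = g • x

theorem IsFull.one : IsFull Γ (1 : Equiv.Perm Ω) :=
  ⟨measurable_id, measurable_id, fun x => ⟨1, (one_smul Γ x).symm⟩⟩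

theorem IsFull.mul {F H : Equiv.Perm Ω} (hF : IsFull Γ F) (hH : IsFull Γ H) :
    IsFull Γ (F * H) := by
  refine ⟨hF.1.comp hH.1, hH.2.1.comp hF.2.1, fun x => ?_⟩
  obtain ⟨g, hg⟩ := hH.2.2 x
  obtain ⟨h, hh⟩ := hF.2.2 (H x)
  exact ⟨h * g, by rw [mul_smul, ← hg, ← hh]; rfl⟩

theorem IsFull.inv {F : Equiv.Perm Ω} (hF : IsFull Γ F) : IsFull Γ F⁻¹ := by
  refine ⟨hF.2.1, hF.1, fun x => ?_⟩
  obtain ⟨g, hg⟩ := hF.2.2 (F⁻¹ x)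
  rw [perm_apply_inv_self] at hg
  refine ⟨g⁻¹, ?_⟩
  conv_rhs => rw [hg]
  rw [inv_smul_smul]

theorem IsFull.lift {a b : Equiv.Perm Ω} (ha : IsFull Γ a) (hb : IsFull Γ b)
    (w : FreeGroup (Fin 2)) : IsFull Γ (FreeGroup.lift ![a, b] w) := by
  have h : ∀ i : Fin 2, IsFull Γ (![a, b] i) := fun i => by fin_cases i <;> assumption
  induction w using FreeGroup.induction_on with
  | C1 => rw [map_one]; exact IsFull.one
  | of i => rw [FreeGroup.lift_apply_of]; exact h i
  | inv_of i ih => rw [map_inv]; exact ih.inv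
  | mul x y hx hy => rw [map_mul]; exact hx.mul hy

variable [Countable Γ] [MeasurableConstSMul Γ Ω] [SMulInvariantMeasure Γ Ω ν] [StandardBorelSpace Ω]

theorem IsFull.measurePreserving {F : Equiv.Perm Ω} (hF : IsFull Γ F) :
    MeasurePreserving F ν ν :=
  measurePreserving_of_orbit hF.1 hF.2.1 hF.2.2

/-- An ergodic transformation of a nonatomic probability space is aperiodic. -/
theorem IsFull.aperiodic [IsProbabilityMeasure ν]
    (hna : ∀ E : Set Ω, MeasurableSet E → ∀ c ≤ ν E, ∃ E' ⊆ E, MeasurableSet E' ∧ ν E' = c)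
    {a : Equiv.Perm Ω} (ha : IsFull Γ a)
    (herg : ∀ A, MeasurableSet A → (∀ x, x ∈ A ↔ a x ∈ A) → ν A = 0 ∨ ν Aᶜ = 0) (n : ℕ) :
    ν {x | (a ^ (n + 1)) x = x} = 0 := by
  have hpow : ∀ k : ℕ, IsFull Γ (a ^ k) := by
    intro k
    induction k with
    | zero => exact IsFull.one
    | succ k ih => rw [pow_succ]; exact ih.mul ha
  set P : Set Ω := {x | (a ^ (n + 1)) x = x} with hP
  have hPm : MeasurableSet P := measurableSet_eq_fun (hpow _).1 measurable_id
  have hcomm : ∀ (k : ℕ) x, (a ^ k) (a x) = a ((a ^ k) x) := fun k x => by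
    rw [← Equiv.Perm.mul_apply, ← pow_succ, pow_succ', Equiv.Perm.mul_apply]
  have hPinv : ∀ x, x ∈ P ↔ a x ∈ P := by
    intro x
    change (a ^ (n + 1)) x = x ↔ (a ^ (n + 1)) (a x) = a x
    rw [hcomm, a.injective.eq_iff]
  refine (herg P hPm hPinv).resolve_right fun hPc => ?_
  have hc : ((2 * (n + 1) : ℕ) : ENNReal)⁻¹ ≤ ν univ := by
    rw [measure_univ, ENNReal.inv_le_one]
    exact_mod_cast (by omega : 1 ≤ 2 * (n + 1))
  obtain ⟨B, -, hBm, hB⟩ := hna univ MeasurableSet.univ _ hc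
  let S : Set Ω := P ∩ ⋃ k : ℕ, (a ^ k) ⁻¹' B
  have hSm : MeasurableSet S := hPm.inter (MeasurableSet.iUnion fun k => (hpow k).1 hBm)
  have hred : ∀ x ∈ P, ∀ k, (a ^ (k % (n + 1))) x = (a ^ k) x := by
    intro x hx k
    have h1 : ∀ q : ℕ, (a ^ ((n + 1) * q)) x = x := by
      intro q
      induction q with
      | zero => rfl
      | succ q ih => rw [Nat.mul_succ, pow_add, Equiv.Perm.mul_apply, hx, ih]
    conv_rhs => rw [← Nat.mod_add_div k (n + 1), pow_add, Equiv.Perm.mul_apply, h1]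
  have hSinv : ∀ x, x ∈ S ↔ a x ∈ S := by
    intro x
    constructor
    · rintro ⟨hx, h⟩
      refine ⟨(hPinv x).1 hx, ?_⟩
      obtain ⟨k, hk⟩ := mem_iUnion.1 h
      refine mem_iUnion.2 ⟨k + n, ?_⟩
      change (a ^ (k + n)) (a x) ∈ B
      rw [← Equiv.Perm.mul_apply, ← pow_succ, add_assoc, pow_add, Equiv.Perm.mul_apply, hx]
      exact hk
    · rintro ⟨hx, h⟩
      refine ⟨(hPinv x).2 hx, ?_⟩
      obtain ⟨k, hk⟩ := mem_iUnion.1 h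
      refine mem_iUnion.2 ⟨k + 1, ?_⟩
      change (a ^ (k + 1)) x ∈ B
      rw [pow_succ, Equiv.Perm.mul_apply]
      exact hk
  have hSle : ν S ≤ 2⁻¹ := by
    calc ν S ≤ ν (⋃ k ∈ Finset.range (n + 1), (a ^ k) ⁻¹' B) := by
          refine measure_mono ?_
          rintro x ⟨hx, h⟩
          obtain ⟨k, hk⟩ := mem_iUnion.1 h
          refine mem_iUnion₂.2 ⟨k % (n + 1), Finset.mem_range.2 (Nat.mod_lt _ (by omega)), ?_⟩
          change (a ^ (k % (n + 1))) x ∈ B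
          rw [hred x hx]
          exact hk
      _ ≤ ∑ k ∈ Finset.range (n + 1), ν ((a ^ k) ⁻¹' B) := measure_biUnion_finset_le _ _
      _ = (n + 1 : ℕ) * ((2 * (n + 1) : ℕ) : ENNReal)⁻¹ := by
          rw [Finset.sum_congr rfl fun k _ =>
            ((hpow k).measurePreserving.measure_preimage hBm.nullMeasurableSet).trans hB]
          simp
      _ = 2⁻¹ := by
          rw [Nat.cast_mul, ENNReal.mul_inv (by simp) (by simp), mul_left_comm,
            ENNReal.mul_inv_cancel (by simp) (by simp), mul_one]
          rfl
  rcases herg S hSm hSinv with h | h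
  · have hBS : B ⊆ S ∪ Pᶜ := by
      intro x hx
      by_cases hxP : x ∈ P
      · exact Or.inl ⟨hxP, mem_iUnion.2 ⟨0, hx⟩⟩
      · exact Or.inr hxP
    have := measure_mono_null hBS (measure_union_null h hPc)
    rw [hB, ENNReal.inv_eq_zero] at this
    exact ENNReal.natCast_ne_top _ this
  · rw [prob_compl_eq_zero_iff hSm] at h
    rw [h] at hSle
    exact absurd hSle (not_le.2 (ENNReal.inv_lt_one.2 (by norm_num)))

open scoped symmDiff in
/-- A free ergodic action of the free group on two generators built from an ergodic
subrelation together with two families of bridges. -/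
theorem exists_pmpAction [IsProbabilityMeasure ν]
    (hna : ∀ E : Set Ω, MeasurableSet E → ∀ c ≤ ν E, ∃ E' ⊆ E, MeasurableSet E' ∧ ν E' = c)
    {B : ℕ → Set Ω} (hB : ∀ j, MeasurableSet (B j))
    (hdense : ∀ A, MeasurableSet A → ∀ ε : ENNReal, 0 < ε → ∃ j, ν (A ∆ B j) ≤ ε)
    {T : Ω → Ω → Prop} (hT : IsErgodicSubrelation Γ ν T)
    {V : Bool → Set Ω} (hV : ∀ t, MeasurableSet (V t))
    {φ : Bool → Ω → Γ} (hφ : ∀ t γ, MeasurableSet {x | φ t x = γ})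
    (hlarge : 1 < ν (V true) + ν (V false))
    (hbridge : ∀ t, ∀ v ∈ V t, ¬ Relation.EqvGen (fun x y => T x y ∨ ∃ t', ∃ v' ∈ V t',
      (t', v') ≠ (t, v) ∧ x = v' ∧ y = φ t' v' • v') v (φ t v • v)) :
    ∃ A : PmpAction (FreeGroup (Fin 2)) Ω ν, A.IsFree ∧ A.IsErgodic ∧
      A.orbitRel ⊆ {q | ∃ g : Γ, q.2 = g • q.1} := by
  obtain ⟨a, ham, ham', haT, haerg⟩ := hT.exists_ergodic hna hB hdense
  have ha : IsFull Γ a := ⟨ham, ham', fun x => hT.orbit _ _ (haT x)⟩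
  obtain ⟨b, Y, β, hbm, hbm', hYm, hY0, hYinv, hborb, hβinj, hβ⟩ := hT.exists_bridging hV hφ hlarge
  have hb : IsFull Γ b := ⟨hbm, hbm', hborb⟩
  let N : Set Ω := ⋃ n : ℕ, {x | (a ^ (n + 1)) x = x}
  have hN : ν N = 0 := measure_iUnion_null fun n => ha.aperiodic hna haerg n
  let Y' : Set Ω := Y ∩ ⋂ g : Γ, (fun x => g • x) ⁻¹' Nᶜ
  have hY'0 : ν Y'ᶜ = 0 := by
    rw [compl_inter, compl_iInter]
    refine measure_union_null hY0 (measure_iUnion_null fun g => ?_)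
    rw [← preimage_compl, compl_compl, measure_preimage_smul, hN]
  have hY'inv : ∀ (g : Γ) (x : Ω), x ∈ Y' → g • x ∈ Y' := by
    rintro g x ⟨h1, h2⟩
    refine ⟨hYinv g x h1, mem_iInter.2 fun h => ?_⟩
    have := mem_iInter.1 h2 (h * g)
    simpa only [mem_preimage, mul_smul] using this
  have hfullY : ∀ {F : Equiv.Perm Ω}, IsFull Γ F → ∀ x, F x ∈ Y' ↔ x ∈ Y' := by
    intro F hF x
    obtain ⟨g, hg⟩ := hF.2.2 x
    rw [hg]
    refine ⟨fun h => ?_, hY'inv g x⟩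
    have := hY'inv g⁻¹ _ h
    rwa [inv_smul_smul] at this
  have hper : ∀ x ∈ Y', ∀ n : ℕ, (a ^ (n + 1)) x ≠ x := by
    intro x hx n h
    have := mem_iInter.1 hx.2 1
    rw [mem_preimage, one_smul] at this
    exact this (mem_iUnion.2 ⟨n, h⟩)
  have hkey := not_related_evalWord hT.equivalence (a := a) (b := b) (Y := Y') (hfullY ha)
    (hfullY hb) haT hper (β := β) (r := fun e => φ e.1 e.2 • e.2) (S := {e | e.2 ∈ V e.1})
    (hβinj.mono inter_subset_left) (fun x hx => (hβ x hx.1).1) (fun x hx => (hβ x hx.1).2.1)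
    (fun x hx => (hβ x hx.1).2.2) (by
      rintro ⟨t, v⟩ hv hcon
      refine hbridge t v hv (hcon.mono ?_)
      rintro x y (h | ⟨⟨t', v'⟩, h1, h2, h3, h4⟩)
      · exact Or.inl h
      · exact Or.inr ⟨t', v', h1, h2, h3, h4⟩)
  have hlift : ∀ w : FreeGroup (Fin 2), FreeGroup.lift ![a, b] w = evalWord a b w.toWord := by
    intro w
    conv_lhs => rw [← FreeGroup.mk_toWord (x := w)]
    exact FreeGroup.lift_mk
  refine ⟨⟨fun w x => FreeGroup.lift ![a, b] w x, fun x => by rw [map_one]; rfl,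
    fun g h x => by rw [map_mul]; rfl, fun g => (ha.lift hb g).1,
    fun g => (ha.lift hb g).measurePreserving⟩, ?_, ?_, ?_⟩
  · refine measure_mono_null ?_ hY'0
    intro x hx hxY
    refine hx fun w hw => ?_
    change FreeGroup.lift ![a, b] w x = x at hw
    rw [hlift] at hw
    have hred : FreeGroup.IsReduced w.toWord := FreeGroup.isReduced_toWord
    by_cases h1 : ∃ p ∈ w.toWord, p.1 = 1
    · refine absurd ?_ (hkey _ hred h1 x hxY)
      rw [hw]
      exact hT.equivalence.refl x
    · push Not at h1
      have h0 : ∀ p ∈ w.toWord, p.1 = 0 := fun p hp => by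
        have := h1 p hp
        omega
      rw [← FreeGroup.toWord_eq_nil_iff]
      cases hL : w.toWord with
      | nil => rfl
      | cons p K =>
        exfalso
        rw [hL] at hw hred h0
        obtain ⟨i, s⟩ := p
        obtain rfl : i = 0 := h0 (i, s) (by simp)
        rw [evalWord_eq_zpow a b K s hred fun p hp => h0 p (List.mem_cons_of_mem _ hp)] at hw
        cases s
        · simp only [cond_false, inv_pow] at hw
          rw [Equiv.Perm.inv_eq_iff_eq] at hw
          exact hper x hxY _ hw.symm
        · exact hper x hxY _ hw
  · intro s hs hinv
    refine haerg s hs fun x => ?_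
    have := hinv (FreeGroup.of 0)
    change (fun x => FreeGroup.lift ![a, b] (FreeGroup.of 0) x) ⁻¹' s = s at this
    simp only [FreeGroup.lift_apply_of] at this
    conv_lhs => rw [← this]
    rfl
  · rintro ⟨x, y⟩ ⟨w, hw⟩
    obtain ⟨g, hg⟩ := (ha.lift hb w).2.2 x
    exact ⟨g, hw.trans hg⟩

end Abstract

/-- A sequence of asymptotically normalized, asymptotically invariant square-summable functions
produces an invariant mean. -/
theorem isAmenable_of_almostInvariant {Γ : Type*} [Group Γ] {f : ℕ → Γ → ℝ}
    (hf : ∀ n, Summable fun x => f n x ^ 2)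
    (hone : Filter.Tendsto (fun n => ∑' x, f n x ^ 2) Filter.atTop (nhds 1))
    (hinv : ∀ h : Γ, Filter.Tendsto (fun n => ∑' x, (f n (h⁻¹ * x) - f n x) ^ 2)
      Filter.atTop (nhds 0)) : IsAmenable Γ := by
  let _ : TopologicalSpace Γ := ⊥
  have : DiscreteTopology Γ := ⟨rfl⟩
  set U : Filter ℕ := (Filter.hyperfilter ℕ : Filter ℕ) with hU
  have hUle : U ≤ Filter.atTop := by
    rw [← Nat.cofinite_eq_atTop]; exact Filter.hyperfilter_le_cofinite
  have hsum : ∀ (F : Γ →ᵇ ℝ) n, Summable fun x => F x * f n x ^ 2 := fun F n => by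
    refine Summable.of_norm_bounded ((hf n).mul_left ‖F‖) fun x => ?_
    rw [norm_mul, Real.norm_of_nonneg (sq_nonneg _)]
    exact mul_le_mul_of_nonneg_right (F.norm_coe_le_norm x) (sq_nonneg _)
  have hbound : ∀ (F : Γ →ᵇ ℝ) n, ‖∑' x, F x * f n x ^ 2‖ ≤ ‖F‖ * ∑' x, f n x ^ 2 := fun F n => by
    refine tsum_of_norm_bounded ((hf n).hasSum.mul_left ‖F‖) fun x => ?_
    rw [norm_mul, Real.norm_of_nonneg (sq_nonneg _)]
    exact mul_le_mul_of_nonneg_right (F.norm_coe_le_norm x) (sq_nonneg _)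
  have hlim : ∀ F : Γ →ᵇ ℝ, ∃ l, Filter.Tendsto (fun n => ∑' x, F x * f n x ^ 2) U (nhds l) := by
    intro F
    have hev : ∀ᶠ n in U, (∑' x, F x * f n x ^ 2) ∈ Metric.closedBall (0 : ℝ) (‖F‖ * 2) := by
      filter_upwards [hUle (hone.eventually_le_const (by norm_num : (1 : ℝ) < 2))] with n hn
      rw [mem_closedBall_zero_iff]
      exact (hbound F n).trans (mul_le_mul_of_nonneg_left hn (norm_nonneg _))
    obtain ⟨l, -, hl⟩ := (isCompact_closedBall (0 : ℝ) (‖F‖ * 2)).ultrafilter_le_nhds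
      ((Filter.hyperfilter ℕ).map fun n => ∑' x, F x * f n x ^ 2)
      (Filter.le_principal_iff.2 hev)
    exact ⟨l, hl⟩
  choose φ hφ using hlim
  refine ⟨{ toFun := φ, map_add' := ?_, map_smul' := ?_ }, ?_, ?_, ?_⟩
  · intro F H
    refine tendsto_nhds_unique (hφ (F + H)) (((hφ F).add (hφ H)).congr fun n => ?_)
    rw [← (hsum F n).tsum_add (hsum H n)]
    exact tsum_congr fun x => by simp [add_mul]
  · intro c F
    refine tendsto_nhds_unique (hφ (c • F)) (((hφ F).const_mul c).congr fun n => ?_)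
    rw [← tsum_mul_left]
    exact tsum_congr fun x => by simp [mul_assoc]
  · intro F hF
    exact ge_of_tendsto' (hφ F) fun n => tsum_nonneg fun x => mul_nonneg (hF x) (sq_nonneg _)
  · refine tendsto_nhds_unique (hφ 1) ((hone.mono_left hUle).congr fun n => ?_)
    simp
  · intro h F
    refine tendsto_nhds_unique (hφ _) ?_
    have hshift : ∀ n, Summable fun x => f n (h * x) ^ 2 := fun n =>
      (Equiv.mulLeft h).summable_iff.2 (hf n)
    have hF : ∀ n, Summable fun x => F x * f n (h * x) ^ 2 := fun n => by
      refine Summable.of_norm_bounded ((hshift n).mul_left ‖F‖) fun x => ?_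
      rw [norm_mul, Real.norm_of_nonneg (sq_nonneg _)]
      exact mul_le_mul_of_nonneg_right (F.norm_coe_le_norm x) (sq_nonneg _)
    have hd : ∀ n, Summable fun x => (f n (h * x) - f n x) ^ 2 := fun n =>
      Summable.of_nonneg_of_le (fun _ => sq_nonneg _)
        (fun x => by nlinarith [sq_nonneg (f n (h * x) + f n x)])
        (((hshift n).mul_left 2).add ((hf n).mul_left 2))
    have hdiff : Filter.Tendsto (fun n => (∑' x, F x * f n (h * x) ^ 2) - ∑' x, F x * f n x ^ 2)
        Filter.atTop (nhds 0) := by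
      have key : ∀ (ε : ℝ), 0 < ε → ∀ n,
          ‖(∑' x, F x * f n (h * x) ^ 2) - ∑' x, F x * f n x ^ 2‖ ≤
            ‖F‖ * (ε⁻¹ * (∑' x, (f n (h * x) - f n x) ^ 2) + 4 * ε * ∑' x, f n x ^ 2) := by
        intro ε hε n
        rw [← (hF n).tsum_sub (hsum F n)]
        have hs := ((((hd n).hasSum.mul_left ε⁻¹).add
          (((hshift n).hasSum.mul_left (2 * ε)).add ((hf n).hasSum.mul_left (2 * ε))))).mul_left ‖F‖
        rw [show (∑' x, f n (h * x) ^ 2) = ∑' x, f n x ^ 2 from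
          (Equiv.mulLeft h).tsum_eq (fun x => f n x ^ 2)] at hs
        refine (tsum_of_norm_bounded hs fun x => ?_).trans_eq (by ring)
        rw [← mul_sub, norm_mul]
        refine mul_le_mul (F.norm_coe_le_norm x) ?_ (norm_nonneg _) (norm_nonneg _)
        set u := f n (h * x)
        set v := f n x
        have h1 : 2 * |u - v| * |u + v| ≤ ε⁻¹ * (u - v) ^ 2 + ε * (u + v) ^ 2 := by
          have h3 := sq_nonneg (ε⁻¹ * |u - v| - |u + v|)
          rw [← sq_abs (u - v), ← sq_abs (u + v)]
          have h4 : ε * ε⁻¹ = 1 := mul_inv_cancel₀ hε.ne'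
          have : ε * (ε⁻¹ * |u - v| - |u + v|) ^ 2 =
            (ε * ε⁻¹) * (ε⁻¹ * |u - v| ^ 2) - 2 * (ε * ε⁻¹) * |u - v| * |u + v|
              + ε * |u + v| ^ 2 := by ring
          rw [h4] at this
          nlinarith [mul_nonneg hε.le h3]
        have h2 : ‖u ^ 2 - v ^ 2‖ = |u - v| * |u + v| := by
          rw [Real.norm_eq_abs, ← abs_mul]; ring_nf
        rw [h2]
        have h5 : (u + v) ^ 2 ≤ 2 * u ^ 2 + 2 * v ^ 2 := by nlinarith [sq_nonneg (u - v)]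
        have h6 := mul_le_mul_of_nonneg_left h5 hε.le
        have h7 : 0 ≤ ε⁻¹ * (u - v) ^ 2 := by positivity
        have h8 : 0 ≤ |u - v| * |u + v| := by positivity
        nlinarith
      have hinv' := hinv h⁻¹
      simp only [inv_inv] at hinv'
      rw [Metric.tendsto_atTop]
      intro δ hδ
      have hε : 0 < δ / (8 * (‖F‖ + 1)) := by positivity
      have hlim := (((hinv'.const_mul (δ / (8 * (‖F‖ + 1)))⁻¹).add
        (hone.const_mul (4 * (δ / (8 * (‖F‖ + 1)))))).const_mul ‖F‖)
      have hlt : ‖F‖ * ((δ / (8 * (‖F‖ + 1)))⁻¹ * 0 + 4 * (δ / (8 * (‖F‖ + 1))) * 1) < δ := by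
        rw [mul_zero, zero_add, mul_one]
        have : ‖F‖ * (4 * (δ / (8 * (‖F‖ + 1)))) = (δ / 2) * (‖F‖ / (‖F‖ + 1)) := by
          field_simp; ring
        rw [this]
        have h9 : ‖F‖ / (‖F‖ + 1) ≤ 1 := by
          rw [div_le_one (by positivity)]; linarith
        nlinarith
      obtain ⟨N, hN⟩ := Filter.eventually_atTop.1 (hlim.eventually_lt_const hlt)
      refine ⟨N, fun n hn => ?_⟩
      rw [dist_zero_right]
      exact (key _ hε n).trans_lt (hN n hn)
    have := (hdiff.mono_left hUle).add (hφ F)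
    rw [zero_add] at this
    refine this.congr fun n => ?_
    rw [sub_add_cancel]
    refine Eq.trans (tsum_congr fun x => ?_)
      ((Equiv.mulLeft h).tsum_eq fun x => F (h⁻¹ * x) * f n x ^ 2)
    simp

theorem lp_two_hasSum_sq {Γ : Type*} (f : lp (fun _ : Γ => ℝ) 2) :
    HasSum (fun x => f x ^ 2) (‖f‖ ^ 2) := by
  have := lp.hasSum_norm (p := 2) (by norm_num) f
  simpa using this

/-- The left regular representation of a group on `ℓ²`. -/
def leftRegular {Γ : Type*} [Group Γ] (h : Γ) : lp (fun _ : Γ => ℝ) 2 →ₗᵢ[ℝ] lp (fun _ : Γ => ℝ) 2 where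
  toFun f := ⟨fun x => f (h⁻¹ * x), memℓp_gen (by
    have := (Equiv.mulLeft h⁻¹).summable_iff.2 (lp_two_hasSum_sq f).summable
    simpa [Function.comp_def] using this)⟩
  map_add' _ _ := rfl
  map_smul' _ _ := rfl
  norm_map' f := by
    refine (sq_eq_sq₀ (norm_nonneg _) (norm_nonneg _)).1 ?_
    refine (lp_two_hasSum_sq _).unique ?_
    exact (Equiv.mulLeft h⁻¹).hasSum_iff.2 (lp_two_hasSum_sq f)

theorem leftRegular_apply {Γ : Type*} [Group Γ] (h : Γ) (f : lp (fun _ : Γ => ℝ) 2) (x : Γ) :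
    leftRegular h f x = f (h⁻¹ * x) := rfl

/-- The Markov operator of a weight `p`, acting on `ℓ²`. -/
def markov {Γ : Type*} [Group Γ] (p : Γ → ℝ) : lp (fun _ : Γ => ℝ) 2 →L[ℝ] lp (fun _ : Γ => ℝ) 2 :=
  ∑' h, p h • (leftRegular h).toContinuousLinearMap

theorem hasSum_markov {Γ : Type*} [Group Γ] {p : Γ → ℝ} (hp : Summable p) (hpos : ∀ h, 0 ≤ p h)
    (f : lp (fun _ : Γ => ℝ) 2) : HasSum (fun h => p h • leftRegular h f) (markov p f) := by
  have hs : Summable fun h => p h • (leftRegular h).toContinuousLinearMap := by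
    refine Summable.of_norm_bounded hp fun h => ?_
    rw [norm_smul, Real.norm_of_nonneg (hpos h)]
    exact mul_le_of_le_one_right (hpos h) (LinearIsometry.norm_toContinuousLinearMap_le _)
  have := hs.hasSum.mapL (ContinuousLinearMap.apply ℝ (lp (fun _ : Γ => ℝ) 2) f)
  exact this

/-- Kesten's criterion: on a nonamenable group, a fully supported Markov operator is a strict
contraction of `ℓ²`. -/
theorem norm_markov_lt_one {Γ : Type*} [Group Γ] (hna : ¬ IsAmenable Γ) {p : Γ → ℝ}
    (hp : HasSum p 1) (hpos : ∀ h, 0 < p h) : ‖markov p‖ < 1 := by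
  by_contra! hge
  refine hna ?_
  have hex : ∀ n : ℕ, ∃ f : lp (fun _ : Γ => ℝ) 2, ‖f‖ < 1 ∧ 1 - 1 / ((n : ℝ) + 1) < ‖markov p f‖ := by
    intro n
    refine (markov p).exists_lt_apply_of_lt_opNorm (lt_of_lt_of_le ?_ hge)
    have : (0 : ℝ) < 1 / ((n : ℝ) + 1) := by positivity
    linarith
  choose f hf1 hfP using hex
  have hPlim : Filter.Tendsto (fun n => ‖markov p (f n)‖) Filter.atTop (nhds 1) := by
    have h0 := (tendsto_one_div_add_atTop_nhds_zero_nat (𝕜 := ℝ)).const_sub 1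
    rw [sub_zero] at h0
    refine tendsto_of_tendsto_of_tendsto_of_le_of_le h0 tendsto_const_nhds
      (fun n => (hfP n).le) fun n => ?_
    refine (hasSum_markov hp.summable (fun h => (hpos h).le) (f n)).norm_le_of_bounded hp fun h => ?_
    rw [norm_smul, Real.norm_of_nonneg (hpos h).le, LinearIsometry.norm_map]
    exact mul_le_of_le_one_right (hpos h).le (hf1 n).le
  have hPle : ∀ n, ‖markov p (f n)‖ ≤ ‖f n‖ := fun n => by
    refine (hasSum_markov hp.summable (fun h => (hpos h).le) (f n)).norm_le_of_bounded
      (by simpa using hp.mul_right ‖f n‖) fun h => ?_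
    rw [norm_smul, Real.norm_of_nonneg (hpos h).le, LinearIsometry.norm_map]
  have hnorm : Filter.Tendsto (fun n => ‖f n‖) Filter.atTop (nhds 1) :=
    tendsto_of_tendsto_of_tendsto_of_le_of_le hPlim tendsto_const_nhds hPle fun n => (hf1 n).le
  refine isAmenable_of_almostInvariant (f := fun n => f n)
    (fun n => (lp_two_hasSum_sq (f n)).summable) ?_ fun h => ?_
  · have := hnorm.pow 2
    rw [one_pow] at this
    exact this.congr fun n => (lp_two_hasSum_sq (f n)).tsum_eq.symm
  have hsq : ∀ n, ∑' x, (f n (h⁻¹ * x) - f n x) ^ 2 = ‖leftRegular h (f n) - f n‖ ^ 2 := fun n =>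
    (lp_two_hasSum_sq (leftRegular h (f n) - f n)).tsum_eq
  simp only [hsq]
  classical
  by_cases h1 : h = 1
  · subst h1
    have : ∀ n, leftRegular 1 (f n) - f n = 0 := fun n => by
      refine sub_eq_zero.2 (lp.ext (funext fun x => ?_))
      rw [leftRegular_apply]; simp
    simp [this]
  set m := min (p h) (p 1)
  have hm : 0 < m := lt_min (hpos h) (hpos 1)
  have hbound : ∀ n, ‖markov p (f n)‖ ≤ 1 - 2 * m + m * ‖leftRegular h (f n) + f n‖ := by
    intro n
    set p' : Γ → ℝ := fun k => p k - (if k = h then m else 0) - (if k = 1 then m else 0) with hp'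
    have hs' : HasSum p' (1 - m - m) := (hp.sub (hasSum_ite_eq h m)).sub (hasSum_ite_eq 1 m)
    have hp'0 : ∀ k, 0 ≤ p' k := by
      intro k
      simp only [hp']
      by_cases hk : k = h
      · subst hk
        simp [h1, m]
      · by_cases hk1 : k = 1
        · subst hk1
          simp [hk, m]
        · simp [hk, hk1, (hpos k).le]
    have hone : leftRegular 1 (f n) = f n := lp.ext (funext fun x => by
      rw [leftRegular_apply]; simp)
    have hs := ((hasSum_markov hp.summable (fun h => (hpos h).le) (f n)).sub
      (hasSum_ite_eq h (m • leftRegular h (f n)))).sub (hasSum_ite_eq 1 (m • f n))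
    have hle : ‖markov p (f n) - m • leftRegular h (f n) - m • f n‖ ≤ 1 - m - m := by
      refine hs.norm_le_of_bounded hs' fun k => ?_
      have : p k • leftRegular k (f n) - (if k = h then m • leftRegular h (f n) else 0)
          - (if k = 1 then m • f n else 0) = p' k • leftRegular k (f n) := by
        simp only [hp', sub_smul]
        congr 1
        · congr 1
          split_ifs with hk
          · rw [hk]
          · rw [zero_smul]
        · split_ifs with hk
          · rw [hk, hone]
          · rw [zero_smul]
      rw [this, norm_smul, Real.norm_of_nonneg (hp'0 k), LinearIsometry.norm_map]
      exact mul_le_of_le_one_right (hp'0 k) (hf1 n).le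
    have hsplit : markov p (f n) = (markov p (f n) - m • leftRegular h (f n) - m • f n)
        + m • (leftRegular h (f n) + f n) := by
      rw [smul_add]; abel
    calc ‖markov p (f n)‖ ≤ ‖markov p (f n) - m • leftRegular h (f n) - m • f n‖
          + ‖m • (leftRegular h (f n) + f n)‖ :=
        (congrArg norm hsplit).le.trans (norm_add_le _ _)
      _ ≤ (1 - m - m) + m * ‖leftRegular h (f n) + f n‖ := by
        refine add_le_add hle (le_of_eq ?_)
        rw [norm_smul, Real.norm_of_nonneg hm.le]
      _ = _ := by ring
  have hlow : Filter.Tendsto (fun n => 2 - (1 - ‖markov p (f n)‖) / m) Filter.atTop (nhds 2) := by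
    have := ((hPlim.const_sub 1).div_const m).const_sub 2
    simpa using this
  have hsumlim : Filter.Tendsto (fun n => ‖leftRegular h (f n) + f n‖) Filter.atTop (nhds 2) := by
    refine tendsto_of_tendsto_of_tendsto_of_le_of_le hlow tendsto_const_nhds (fun n => ?_) fun n => ?_
    · have := hbound n
      have h2 : (1 - ‖markov p (f n)‖) / m * m = 1 - ‖markov p (f n)‖ := div_mul_cancel₀ _ hm.ne'
      simp only
      nlinarith
    · refine (norm_add_le _ _).trans ?_
      rw [LinearIsometry.norm_map]
      linarith [hf1 n]
  have hfin := ((hnorm.pow 2).const_mul 4).sub (hsumlim.pow 2)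
  have : (4 : ℝ) * 1 ^ 2 - 2 ^ 2 = 0 := by norm_num
  rw [this] at hfin
  refine hfin.congr fun n => ?_
  have hpar := parallelogram_law_with_norm ℝ (leftRegular h (f n)) (f n)
  rw [LinearIsometry.norm_map] at hpar
  nlinarith

open scoped ENNReal in
/-- Convolution of weights on a group. -/
def conv {Γ : Type*} [Group Γ] (a b : Γ → ℝ≥0∞) (g : Γ) : ℝ≥0∞ := ∑' h, a h * b (h⁻¹ * g)

section conv

open scoped ENNReal

variable {Γ : Type*} [Group Γ]

theorem conv_assoc (a b c : Γ → ℝ≥0∞) : conv (conv a b) c = conv a (conv b c) := by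
  funext g
  simp only [conv, ← ENNReal.tsum_mul_right, ← ENNReal.tsum_mul_left]
  rw [ENNReal.tsum_comm]
  refine tsum_congr fun k => ?_
  rw [← (Equiv.mulLeft k).tsum_eq]
  refine tsum_congr fun h => ?_
  simp [mul_assoc]

theorem tsum_conv (a b : Γ → ℝ≥0∞) : ∑' g, conv a b g = (∑' g, a g) * ∑' g, b g := by
  simp only [conv]
  rw [ENNReal.tsum_comm, ← ENNReal.tsum_mul_right]
  refine tsum_congr fun h => ?_
  rw [ENNReal.tsum_mul_left]
  exact congrArg _ ((Equiv.mulLeft h⁻¹).tsum_eq b)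

theorem conv_inv (a b : Γ → ℝ≥0∞) (g : Γ) :
    conv a b g⁻¹ = conv (fun h => b h⁻¹) (fun h => a h⁻¹) g := by
  simp only [conv]
  rw [← (Equiv.mulLeft g).tsum_eq fun h => b h⁻¹ * a (h⁻¹ * g)⁻¹]
  refine tsum_congr fun h => ?_
  simp [mul_comm]

open Classical in
/-- The convolution powers of a weight. -/
def convPow (p : Γ → ℝ≥0∞) : ℕ → Γ → ℝ≥0∞
  | 0 => fun g => if g = 1 then 1 else 0
  | n + 1 => conv p (convPow p n)

theorem convPow_zero_conv (p a : Γ → ℝ≥0∞) : conv (convPow p 0) a = a := by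
  funext g
  rw [conv, tsum_eq_single 1]
  · simp [convPow]
  · intro h hh; simp [convPow, hh]

theorem conv_convPow (p : Γ → ℝ≥0∞) (m n : ℕ) :
    conv (convPow p m) (convPow p n) = convPow p (m + n) := by
  induction m with
  | zero => rw [convPow_zero_conv, zero_add]
  | succ m ih => rw [convPow, conv_assoc, ih, Nat.succ_add, convPow]

theorem convPow_one (p : Γ → ℝ≥0∞) : convPow p 1 = p := by
  funext g
  rw [convPow, conv, tsum_eq_single g]
  · simp [convPow]
  · intro h hh
    have : h⁻¹ * g ≠ 1 := fun h1 => hh (inv_mul_eq_one.1 h1)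
    simp [convPow, this]

theorem tsum_convPow {p : Γ → ℝ≥0∞} (hp : ∑' g, p g = 1) (n : ℕ) : ∑' g, convPow p n g = 1 := by
  induction n with
  | zero => simp [convPow]
  | succ n ih => rw [convPow, tsum_conv, hp, ih, one_mul]

theorem convPow_inv {p : Γ → ℝ≥0∞} (hp : ∀ g, p g⁻¹ = p g) (n : ℕ) (g : Γ) :
    convPow p n g⁻¹ = convPow p n g := by
  induction n generalizing g with
  | zero => by_cases hg : g = 1 <;> simp [convPow, hg]
  | succ n ih =>
    rw [convPow, conv_inv]
    simp only [ih, hp]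
    nth_rewrite 2 [← convPow_one p]
    rw [conv_convPow, ← convPow]

theorem convPow_ofReal {p : Γ → ℝ} (hp : Summable p) (hpos : ∀ h, 0 ≤ p h) (n : ℕ) (g : Γ) :
    convPow (fun h => ENNReal.ofReal (p h)) n g ≤ ENNReal.ofReal (‖markov p‖ ^ n) := by
  classical
  set δ : lp (fun _ : Γ => ℝ) 2 := lp.single 2 1 (1 : ℝ)
  have key : ∀ n g, 0 ≤ (markov p ^ n) δ g ∧
      convPow (fun h => ENNReal.ofReal (p h)) n g = ENNReal.ofReal ((markov p ^ n) δ g) := by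
    intro n
    induction n with
    | zero =>
      intro g
      rw [pow_zero, one_apply_eq_self, convPow, lp.single_apply]
      by_cases hg : g = 1
      · subst hg; simp
      · simp [hg]
    | succ n ih =>
      intro g
      have hs : HasSum (fun h => p h * (markov p ^ n) δ (h⁻¹ * g)) ((markov p ^ (n + 1)) δ g) := by
        have := (hasSum_markov hp hpos ((markov p ^ n) δ)).mapL
          (lp.evalCLM (𝕜 := ℝ) (E := fun _ : Γ => ℝ) (p := 2) g)
        rw [pow_succ']
        exact this
      have h0 : ∀ h, 0 ≤ p h * (markov p ^ n) δ (h⁻¹ * g) := fun h =>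
        mul_nonneg (hpos h) (ih _).1
      refine ⟨hs.nonneg h0, ?_⟩
      rw [← hs.tsum_eq, ENNReal.ofReal_tsum_of_nonneg h0 hs.summable, convPow, conv]
      refine tsum_congr fun h => ?_
      rw [(ih _).2, ENNReal.ofReal_mul (hpos h)]
  rw [(key n g).2]
  refine ENNReal.ofReal_le_ofReal ?_
  calc (markov p ^ n) δ g ≤ ‖(markov p ^ n) δ g‖ := le_abs_self _
    _ ≤ ‖(markov p ^ n) δ‖ := lp.norm_apply_le_norm (by norm_num) _ _
    _ ≤ ‖markov p ^ n‖ * ‖δ‖ := ContinuousLinearMap.le_opNorm _ _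
    _ = ‖markov p ^ n‖ := by rw [lp.norm_single (by norm_num)]; simp
    _ ≤ ‖markov p‖ ^ n := by
      rcases Nat.eq_zero_or_pos n with rfl | hn
      · rw [pow_zero, pow_zero]; exact ContinuousLinearMap.norm_id_le
      · exact norm_pow_le' _ hn

theorem exists_symmetric_weight (Γ : Type*) [Group Γ] [Countable Γ] :
    ∃ p : Γ → ℝ, HasSum p 1 ∧ (∀ h, 0 < p h) ∧ ∀ h, p h⁻¹ = p h := by
  obtain ⟨e, he⟩ := exists_injective_nat Γ
  have hs : Summable fun g : Γ => (1 / 2 : ℝ) ^ e g := summable_geometric_two.comp_injective he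
  have hs2 : Summable fun g : Γ => (1 / 2 : ℝ) ^ e g + (1 / 2 : ℝ) ^ e g⁻¹ :=
    hs.add ((Equiv.inv Γ).summable_iff.2 hs)
  have hpos : ∀ g : Γ, 0 < (1 / 2 : ℝ) ^ e g + (1 / 2 : ℝ) ^ e g⁻¹ := fun g => by positivity
  have hS := hs2.tsum_pos (fun g => (hpos g).le) 1 (hpos 1)
  have h1 := hs2.hasSum.div_const (∑' g, ((1 / 2 : ℝ) ^ e g + (1 / 2 : ℝ) ^ e g⁻¹))
  rw [div_self hS.ne'] at h1
  refine ⟨_, h1, fun g => div_pos (hpos g) hS, fun g => ?_⟩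
  simp only [inv_inv]
  rw [add_comm]

/-- A convolution semigroup of symmetric probability weights, decaying exponentially in sup norm. -/
structure IsDecayingSemigroup (q : ℕ → Γ → ℝ≥0∞) : Prop where
  tsum_eq : ∀ n, ∑' g, q n g = 1
  conv_eq : ∀ m n g, ∑' h, q m h * q n (h⁻¹ * g) = q (m + n) g
  inv_eq : ∀ n g, q n g⁻¹ = q n g
  le_pow : ∀ n g, q n g ≤ 8⁻¹ ^ n

theorem exists_isDecayingSemigroup [Countable Γ] (hna : ¬ IsAmenable Γ) :
    ∃ q : ℕ → Γ → ℝ≥0∞, IsDecayingSemigroup q := by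
  obtain ⟨p, hp, hpos, hsymm⟩ := exists_symmetric_weight Γ
  obtain ⟨K, hK⟩ := exists_pow_lt_of_lt_one (by norm_num : (0 : ℝ) < 8⁻¹)
    (norm_markov_lt_one hna hp hpos)
  refine ⟨fun n => convPow (fun h => ENNReal.ofReal (p h)) (K * n), fun n => tsum_convPow ?_ _,
    fun m n g => ?_, fun n g => convPow_inv (fun h => by rw [hsymm]) _ _, fun n g => ?_⟩
  · rw [← ENNReal.ofReal_tsum_of_nonneg (fun h => (hpos h).le) hp.summable, hp.tsum_eq,
      ENNReal.ofReal_one]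
  · rw [mul_add, ← conv_convPow]
    rfl
  · refine (convPow_ofReal hp.summable (fun h => (hpos h).le) _ _).trans ?_
    rw [pow_mul, ENNReal.ofReal_pow (by positivity)]
    refine pow_le_pow_left' ?_ n
    calc _ ≤ ENNReal.ofReal 8⁻¹ := ENNReal.ofReal_le_ofReal hK.le
      _ = 8⁻¹ := by rw [ENNReal.ofReal_inv_of_pos (by norm_num)]; simp

end conv

section Labelling

open scoped ENNReal

variable {Γ Ω : Type*} [Group Γ] [MulAction Γ Ω]

/-- The increment-labelled walk steps: a type, a direction and an increment. -/
abbrev Step (Γ : Type*) := ℕ × Bool × Γ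

/-- The endpoint of a walk started at `1`; the most recent step comes first. -/
def endpoint (l : List (Step Γ)) : Γ := (l.map fun s => s.2.2).prod

/-- The proposal traversed by a step made from `u`: the vertex making it and its type. -/
def proposal (s : Step Γ) (u : Γ) : Γ × ℕ := (if s.2.1 then u else s.2.2 * u, s.1)

/-- The label that a proposal must carry for a given step to traverse it. -/
def required (s : Step Γ) : Γ := if s.2.1 then s.2.2 else s.2.2⁻¹

/-- The proposals traversed by a walk, together with their required labels. -/
def entries : List (Step Γ) → List ((Γ × ℕ) × Γ)
  | [] => []
  | s :: l => (proposal s (endpoint l), required s) :: entries l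

/-- The walks that the labels of `x` allow, among the proposals in `Q`. -/
def Valid (κ : ℕ → Ω → Γ) (Q : Set (Γ × ℕ)) (x : Ω) (l : List (Step Γ)) : Prop :=
  ∀ e ∈ entries l, κ e.1.2 (e.1.1 • x) = e.2 ∧ e.1 ∈ Q

/-- The self-avoiding walks. -/
def Simple : List (Step Γ) → Prop
  | [] => True
  | s :: l => Simple l ∧ ∀ l', l' <:+ l → endpoint (s :: l) ≠ endpoint l'

theorem endpoint_cons (s : Step Γ) (l : List (Step Γ)) :
    endpoint (s :: l) = s.2.2 * endpoint l := by simp [endpoint]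

theorem entries_suffix {l l' : List (Step Γ)} (h : l' <:+ l) : entries l' <:+ entries l := by
  induction l with
  | nil => rw [List.suffix_nil.1 h]
  | cons s l ih =>
    rcases List.suffix_cons_iff.1 h with rfl | h
    · exact List.suffix_rfl
    · exact (ih h).trans (List.suffix_cons _ _)

theorem Simple.suffix {l l' : List (Step Γ)} (hl : Simple l) (h : l' <:+ l) : Simple l' := by
  induction l with
  | nil => rw [List.suffix_nil.1 h]; trivial
  | cons s l ih =>
    rcases List.suffix_cons_iff.1 h with rfl | h
    · exact hl
    · exact ih hl.1 h

theorem Valid.suffix {κ : ℕ → Ω → Γ} {Q : Set (Γ × ℕ)} {x : Ω} {l l' : List (Step Γ)}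
    (hl : Valid κ Q x l) (h : l' <:+ l) : Valid κ Q x l' :=
  fun e he => hl e ((entries_suffix h).mem he)

theorem valid_cons {κ : ℕ → Ω → Γ} {Q : Set (Γ × ℕ)} {x : Ω} {s : Step Γ} {l : List (Step Γ)} :
    Valid κ Q x (s :: l) ↔ (κ s.1 ((proposal s (endpoint l)).1 • x) = required s ∧
      proposal s (endpoint l) ∈ Q) ∧ Valid κ Q x l := by
  simp only [Valid, entries, List.forall_mem_cons]
  rfl

theorem exists_simple {κ : ℕ → Ω → Γ} {Q : Set (Γ × ℕ)} {x : Ω} {l : List (Step Γ)}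
    (hl : Valid κ Q x l) : ∃ l', endpoint l' = endpoint l ∧ Valid κ Q x l' ∧ Simple l' := by
  induction l with
  | nil => exact ⟨[], rfl, hl, trivial⟩
  | cons s l ih =>
    obtain ⟨l', h1, h2, h3⟩ := ih (valid_cons.1 hl).2
    by_cases h : ∃ k, k <:+ l' ∧ endpoint (s :: l') = endpoint k
    · obtain ⟨k, hk, hk'⟩ := h
      refine ⟨k, ?_, h2.suffix hk, h3.suffix hk⟩
      rw [← hk', endpoint_cons, endpoint_cons, h1]
    · push Not at h
      refine ⟨s :: l', by rw [endpoint_cons, endpoint_cons, h1], valid_cons.2 ⟨?_, h2⟩, h3, h⟩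
      rw [h1]
      exact (valid_cons.1 hl).1

/-- The two endpoints of a traversed proposal are visited. -/
theorem endpoint_of_mem_entries {l : List (Step Γ)} {e : (Γ × ℕ) × Γ} (he : e ∈ entries l) :
    (∃ l', l' <:+ l ∧ endpoint l' = e.1.1) ∧ ∃ l', l' <:+ l ∧ endpoint l' = e.2 * e.1.1 := by
  induction l with
  | nil => simp [entries] at he
  | cons s l ih =>
    rcases List.mem_cons.1 he with rfl | he
    · obtain ⟨i, b, γ⟩ := s
      cases b
      · exact ⟨⟨_, List.suffix_rfl, by simp [proposal, endpoint_cons]⟩,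
          l, List.suffix_cons _ _, by simp [proposal, required]⟩
      · exact ⟨⟨l, List.suffix_cons _ _, by simp [proposal]⟩,
          _, List.suffix_rfl, by simp [proposal, required, endpoint_cons]⟩
    · obtain ⟨⟨l₁, h₁, h₁'⟩, l₂, h₂, h₂'⟩ := ih he
      exact ⟨⟨l₁, h₁.trans (List.suffix_cons _ _), h₁'⟩,
        l₂, h₂.trans (List.suffix_cons _ _), h₂'⟩

theorem nodup_entries {κ : ℕ → Ω → Γ} {Q : Set (Γ × ℕ)} {x : Ω} {l : List (Step Γ)}
    (hl : Valid κ Q x l) (hs : Simple l) : ((entries l).map Prod.fst).Nodup := by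
  induction l with
  | nil => simp [entries]
  | cons s l ih =>
    have hv := valid_cons.1 hl
    simp only [entries, List.map_cons, List.nodup_cons]
    refine ⟨fun hmem => ?_, ih hv.2 hs.1⟩
    obtain ⟨e, he, hee⟩ := List.mem_map.1 hmem
    have hval : e.2 = required s := by
      rw [← (hl e (List.mem_cons_of_mem _ he)).1, hee]
      exact hv.1.1
    obtain ⟨⟨l₁, h₁, h₁'⟩, l₂, h₂, h₂'⟩ := endpoint_of_mem_entries he
    rw [hee] at h₁' h₂'
    rw [hval] at h₂'
    obtain ⟨i, b, γ⟩ := s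
    cases b
    · exact hs.2 l₁ h₁ (by simpa [proposal, endpoint_cons] using h₁'.symm)
    · exact hs.2 l₂ h₂ (by simpa [proposal, required, endpoint_cons] using h₂'.symm)

/-- The proposals made by points satisfying `P`, as edges between points of `Ω`. -/
def Edge (κ : ℕ → Ω → Γ) (P : Ω → ℕ → Prop) (x y : Ω) : Prop := ∃ i, P x i ∧ y = κ i x • x

theorem eqvGen_of_valid {κ : ℕ → Ω → Γ} {P : Ω → ℕ → Prop} {Q : Set (Γ × ℕ)} {x : Ω}
    (hPQ : ∀ p ∈ Q, P (p.1 • x) p.2) {l : List (Step Γ)} (hl : Valid κ Q x l) :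
    Relation.EqvGen (Edge κ P) x (endpoint l • x) := by
  induction l with
  | nil => simpa [endpoint] using Relation.EqvGen.refl x
  | cons s l ih =>
    have hv := valid_cons.1 hl
    have hP := hPQ _ hv.1.2
    have hκ := hv.1.1
    refine (ih hv.2).trans _ _ _ ?_
    obtain ⟨i, b, γ⟩ := s
    rw [endpoint_cons]
    cases b
    · refine (Relation.EqvGen.rel _ _ ⟨i, ?_, ?_⟩).symm
      · simpa [proposal] using hP
      · simp only [proposal, required, Bool.false_eq_true, if_false] at hκ
        rw [hκ, mul_smul, inv_smul_smul]
    · refine Relation.EqvGen.rel _ _ ⟨i, ?_, ?_⟩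
      · simpa [proposal] using hP
      · simp only [proposal, required, if_true] at hκ
        rw [hκ, mul_smul]

theorem exists_valid_of_eqvGen {κ : ℕ → Ω → Γ} {P : Ω → ℕ → Prop} {Q : Set (Γ × ℕ)} {x y : Ω}
    (hPQ : ∀ p : Γ × ℕ, P (p.1 • x) p.2 → p ∈ Q) (h : Relation.EqvGen (Edge κ P) x y) :
    ∃ l, Valid κ Q x l ∧ y = endpoint l • x := by
  have key : ∀ a b, Relation.EqvGen (Edge κ P) a b →
      ((∃ l, Valid κ Q x l ∧ a = endpoint l • x) ↔ ∃ l, Valid κ Q x l ∧ b = endpoint l • x) := by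
    intro a b hab
    induction hab with
    | rel a b hab =>
      obtain ⟨i, hP, rfl⟩ := hab
      constructor
      · rintro ⟨l, hl, rfl⟩
        refine ⟨(i, true, κ i (endpoint l • x)) :: l, valid_cons.2 ⟨⟨?_, hPQ _ ?_⟩, hl⟩, ?_⟩
        · simp [proposal, required]
        · simpa [proposal] using hP
        · rw [endpoint_cons, mul_smul]
      · rintro ⟨l, hl, hla⟩
        have ha : a = ((κ i a)⁻¹ * endpoint l) • x := by rw [mul_smul, ← hla, inv_smul_smul]
        refine ⟨(i, false, (κ i a)⁻¹) :: l, valid_cons.2 ⟨⟨?_, hPQ _ ?_⟩, hl⟩, ?_⟩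
        · simp only [proposal, required, Bool.false_eq_true, if_false, inv_inv]
          rw [← ha]
        · simp only [proposal, Bool.false_eq_true, if_false]
          rw [← ha]; exact hP
        · rw [endpoint_cons]; exact ha
    | refl a => rfl
    | symm a b _ ih => exact ih.symm
    | trans a b c _ _ ih₁ ih₂ => exact ih₁.trans ih₂
  exact (key x y h).1 ⟨[], by simp [Valid, entries], by simp [endpoint]⟩

/-- The equivalence relation generated by the proposals of type at least two. -/
def sparse (κ : ℕ → Ω → Γ) : Ω → Ω → Prop := Relation.EqvGen (Edge κ fun _ i => 2 ≤ i)

/-- The points whose proposal of type `t` is a bridge of the graph of all proposals. -/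
def bridges (κ : ℕ → Ω → Γ) (t : ℕ) : Set Ω :=
  {x | ¬ ∃ l, Valid κ {p | p ≠ ((1 : Γ), t)} x l ∧ endpoint l • x = κ t x • x}

theorem not_eqvGen_of_mem_bridges {κ : ℕ → Ω → Γ} {t : Bool} {v : Ω}
    (hv : v ∈ bridges κ t.toNat) :
    ¬ Relation.EqvGen (fun x y => sparse κ x y ∨ ∃ t', ∃ v' ∈ bridges κ (Bool.toNat t'),
      (t', v') ≠ (t, v) ∧ x = v' ∧ y = κ t'.toNat v' • v') v (κ t.toNat v • v) := by
  intro h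
  have hle : Relation.EqvGen (Edge κ fun x i => ¬ (x = v ∧ i = t.toNat)) v (κ t.toNat v • v) := by
    refine Relation.EqvGen.eqvGen_le ?_ _ _ h
    rintro x y (hT | ⟨t', v', -, hne, rfl, rfl⟩)
    · refine Relation.EqvGen.mono ?_ _ _ hT
      rintro a b ⟨i, hi, rfl⟩
      refine ⟨i, fun h' => ?_, rfl⟩
      have := Bool.toNat_le t
      omega
    · refine Relation.EqvGen.rel _ _ ⟨t'.toNat, fun h' => hne ?_, rfl⟩
      rw [h'.1, show t' = t by cases t <;> cases t' <;> simp_all]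
  obtain ⟨l, hl, hlv⟩ := exists_valid_of_eqvGen (Q := {p | p ≠ ((1 : Γ), t.toNat)})
    (fun p hp hp' => hp ⟨by rw [hp', one_smul], by rw [hp']⟩) hle
  exact hv ⟨l, hl, hlv.symm⟩

theorem orbit_of_sparse {κ : ℕ → Ω → Γ} {x y : Ω} (h : sparse κ x y) : ∃ g : Γ, y = g • x := by
  obtain ⟨l, -, hl⟩ := exists_valid_of_eqvGen (Q := univ) (fun p _ => mem_univ p) h
  exact ⟨_, hl⟩

end Labelling

section Bridges

open scoped ENNReal

variable {Γ Ω : Type*} [Group Γ] [MeasurableSpace Ω] [MulAction Γ Ω]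

/-- The labels of distinct proposals are independent, those of type `i` having law `q (i + 1)`. -/
structure IsLabelling (ν : Measure Ω) (q : ℕ → Γ → ℝ≥0∞) (κ : ℕ → Ω → Γ) : Prop where
  measurableSet_eq : ∀ i γ, MeasurableSet {x | κ i x = γ}
  measure_eq : ∀ L : List ((Γ × ℕ) × Γ), (L.map Prod.fst).Nodup →
    ν {x | ∀ e ∈ L, κ e.1.2 (e.1.1 • x) = e.2} = (L.map fun e => q (e.1.2 + 1) e.2).prod

/-- The probability that a self-avoiding walk is allowed. -/
def weight (q : ℕ → Γ → ℝ≥0∞) (l : List (Step Γ)) : ℝ≥0∞ :=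
  (l.map fun s => q (s.1 + 1) s.2.2).prod

theorem weight_entries {q : ℕ → Γ → ℝ≥0∞} (hq : IsDecayingSemigroup q) (l : List (Step Γ)) :
    ((entries l).map fun e => q (e.1.2 + 1) e.2).prod = weight q l := by
  induction l with
  | nil => rfl
  | cons s l ih =>
    obtain ⟨i, b, γ⟩ := s
    simp only [entries, List.map_cons, List.prod_cons, ih, weight]
    cases b <;> simp [proposal, required, hq.inv_eq]

/-- Summing over the walks of length `m`, the expected number of returns decays geometrically. -/
theorem tsum_weight_le {q : ℕ → Γ → ℝ≥0∞} (hq : IsDecayingSemigroup q) (m n : ℕ) :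
    ∑' l : List (Step Γ), (if l.length = m then weight q l * q n (endpoint l) else 0) ≤
      8⁻¹ ^ n * 2⁻¹ ^ m := by
  induction m generalizing n with
  | zero =>
    rw [tsum_eq_single []]
    · simpa [weight, endpoint] using hq.le_pow n 1
    · intro l hl
      simp [hl]
  | succ m ih =>
    have hinj : Function.Injective fun p : Step Γ × List (Step Γ) => p.1 :: p.2 := by
      rintro ⟨s, l⟩ ⟨s', l'⟩ h
      simpa using h
    rw [← hinj.tsum_eq, ENNReal.tsum_prod', ENNReal.tsum_comm]
    · have hstep : ∀ (l : List (Step Γ)), ∑' s : Step Γ, (if (s :: l).length = m + 1 then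
          weight q (s :: l) * q n (endpoint (s :: l)) else 0) =
          ∑' i : ℕ, 2 * (if l.length = m then weight q l * q (i + 1 + n) (endpoint l) else 0) := by
        intro l
        by_cases hl : l.length = m
        · simp only [List.length_cons, hl, if_true]
          rw [ENNReal.tsum_prod']
          refine tsum_congr fun i => ?_
          rw [ENNReal.tsum_prod', tsum_bool]
          have : ∀ b : Bool, ∑' γ : Γ, weight q ((i, b, γ) :: l) * q n (endpoint ((i, b, γ) :: l)) =
              weight q l * q (i + 1 + n) (endpoint l) := by
            intro b
            rw [← hq.conv_eq, ← ENNReal.tsum_mul_left, ← (Equiv.inv Γ).tsum_eq]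
            refine tsum_congr fun γ => ?_
            simp only [weight, List.map_cons, List.prod_cons, endpoint_cons, Equiv.inv_apply,
              hq.inv_eq]
            ring
          rw [this, this, two_mul]
        · simp [hl]
      simp only [hstep]
      rw [ENNReal.tsum_comm]
      calc _ ≤ ∑' i : ℕ, (8⁻¹ ^ n * 2⁻¹ ^ m * 4⁻¹ * 2⁻¹ ^ i : ℝ≥0∞) := by
            refine ENNReal.tsum_le_tsum fun i => ?_
            rw [ENNReal.tsum_mul_left]
            calc _ ≤ 2 * (8⁻¹ ^ (i + 1 + n) * 2⁻¹ ^ m : ℝ≥0∞) := by gcongr; exact ih _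
              _ = 8⁻¹ ^ n * 2⁻¹ ^ m * (2 * 8⁻¹) * 8⁻¹ ^ i := by ring
              _ ≤ _ := by
                have h1 : (2 * 8⁻¹ : ℝ≥0∞) = 4⁻¹ := by
                  rw [show (8 : ℝ≥0∞) = 2 * 4 by norm_num,
                    ENNReal.mul_inv (by simp) (by simp), ← mul_assoc,
                    ENNReal.mul_inv_cancel (by simp) (by simp), one_mul]
                rw [h1]
                gcongr
                norm_num
        _ = (8⁻¹ ^ n * 2⁻¹ ^ m * 4⁻¹ * 2 : ℝ≥0∞) := by rw [ENNReal.tsum_mul_left, ENNReal.tsum_geometric_two]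
        _ = _ := by
          have h1 : (4⁻¹ * 2 : ℝ≥0∞) = 2⁻¹ := by
            rw [show (4 : ℝ≥0∞) = 2 * 2 by norm_num, ENNReal.mul_inv (by simp) (by simp), mul_assoc,
              ENNReal.inv_mul_cancel (by simp) (by simp), mul_one]
          rw [mul_assoc _ _ 2, h1, pow_succ, mul_assoc]
    · intro l hl
      rcases l with _ | ⟨s, l⟩
      · simp at hl
      · exact ⟨(s, l), rfl⟩

variable [Countable Γ]

theorem IsLabelling.measurableSet_valid [MeasurableConstSMul Γ Ω] {ν : Measure Ω}
    {q : ℕ → Γ → ℝ≥0∞} {κ : ℕ → Ω → Γ} (hκ : IsLabelling ν q κ) (Q : Set (Γ × ℕ))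
    (l : List (Step Γ)) : MeasurableSet {x | Valid κ Q x l} := by
  have : {x | Valid κ Q x l} = ⋂ e ∈ {e | e ∈ entries l},
      {x | κ e.1.2 (e.1.1 • x) = e.2 ∧ e.1 ∈ Q} := by
    ext x; simp [Valid]
  rw [this]
  refine MeasurableSet.biInter (to_countable _) fun e _ => ?_
  exact (measurable_const_smul e.1.1 (hκ.measurableSet_eq e.1.2 e.2)).inter (.const _)

theorem IsLabelling.measurableSet_bridges [MeasurableConstSMul Γ Ω] [StandardBorelSpace Ω]
    {ν : Measure Ω} {q : ℕ → Γ → ℝ≥0∞} {κ : ℕ → Ω → Γ} (hκ : IsLabelling ν q κ) (t : ℕ) :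
    MeasurableSet (bridges κ t) := by
  have : bridges κ t = (⋃ (l : List (Step Γ)) (γ : Γ), {x | Valid κ {p | p ≠ ((1 : Γ), t)} x l} ∩
      ({x | κ t x = γ} ∩ {x | endpoint l • x = γ • x}))ᶜ := by
    ext x; simp [bridges]
  rw [this]
  exact (MeasurableSet.iUnion fun l => .iUnion fun γ => (hκ.measurableSet_valid _ l).inter
    ((hκ.measurableSet_eq t γ).inter
      (measurableSet_eq_fun (measurable_const_smul _) (measurable_const_smul _)))).compl

theorem IsLabelling.measurableSet_sparse_smul [MeasurableConstSMul Γ Ω] [StandardBorelSpace Ω]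
    {ν : Measure Ω} {q : ℕ → Γ → ℝ≥0∞} {κ : ℕ → Ω → Γ} (hκ : IsLabelling ν q κ) (g : Γ) :
    MeasurableSet {x | sparse κ x (g • x)} := by
  have : {x | sparse κ x (g • x)} = ⋃ l : List (Step Γ), {x | Valid κ {p | 2 ≤ p.2} x l} ∩
      {x | g • x = endpoint l • x} := by
    ext x
    simp only [mem_ofPred_eq, mem_iUnion, mem_inter_iff]
    constructor
    · exact fun h => exists_valid_of_eqvGen (fun p hp => hp) h
    · rintro ⟨l, hl, h⟩
      rw [h]
      exact eqvGen_of_valid (fun p hp => hp) hl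
  rw [this]
  exact .iUnion fun l => (hκ.measurableSet_valid _ l).inter
    (measurableSet_eq_fun (measurable_const_smul g) (measurable_const_smul _))

theorem IsLabelling.measure_compl_bridges_le {ν : Measure Ω}
    {q : ℕ → Γ → ℝ≥0∞} (hq : IsDecayingSemigroup q) {κ : ℕ → Ω → Γ} (hκ : IsLabelling ν q κ)
    (hfree : ∀ᵐ x ∂ν, ∀ g : Γ, g • x = x → g = 1) (t : ℕ) : ν (bridges κ t)ᶜ ≤ 4⁻¹ := by
  have hsub : (bridges κ t)ᶜ ≤ᵐ[ν] ⋃ l : List (Step Γ), {x | Valid κ {p | p ≠ ((1 : Γ), t)} x l ∧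
      Simple l ∧ endpoint l = κ t x} := by
    filter_upwards [hfree] with x hxf hx
    obtain ⟨l, hl, hlx⟩ := not_not.1 hx
    obtain ⟨l', h1, h2, h3⟩ := exists_simple hl
    refine mem_iUnion.2 ⟨l', h2, h3, h1.trans ?_⟩
    refine (inv_mul_eq_one.1 (hxf _ ?_)).symm
    rw [mul_smul, hlx, inv_smul_smul]
  have hl : ∀ l : List (Step Γ), ν {x | Valid κ {p | p ≠ ((1 : Γ), t)} x l ∧
      Simple l ∧ endpoint l = κ t x} ≤ weight q l * q (t + 1) (endpoint l) := by
    intro l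
    by_cases hgood : (((((1 : Γ), t), endpoint l) :: entries l).map Prod.fst).Nodup
    · rw [← weight_entries hq, mul_comm]
      have := hκ.measure_eq _ hgood
      simp only [List.map_cons, List.prod_cons] at this
      rw [← this]
      refine measure_mono fun x hx => ?_
      intro e he
      rcases List.mem_cons.1 he with rfl | he
      · simpa using hx.2.2.symm
      · exact (hx.1 e he).1
    · refine le_of_eq_of_le ?_ zero_le
      refine measure_mono_null (t := ∅) (fun x hx => hgood ?_) measure_empty
      rw [List.map_cons, List.nodup_cons]
      refine ⟨fun h => ?_, nodup_entries hx.1 hx.2.1⟩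
      obtain ⟨e, he, hee⟩ := List.mem_map.1 h
      exact (hx.1 e he).2 hee
  calc ν (bridges κ t)ᶜ ≤ _ := measure_mono_ae hsub
    _ ≤ _ := measure_iUnion_le _
    _ ≤ ∑' l : List (Step Γ), weight q l * q (t + 1) (endpoint l) := ENNReal.tsum_le_tsum hl
    _ = ∑' (l : List (Step Γ)) (m : ℕ),
        if l.length = m then weight q l * q (t + 1) (endpoint l) else 0 := by
      refine tsum_congr fun l => ?_
      rw [tsum_eq_single l.length]
      · simp
      · exact fun m hm => if_neg hm.symm
    _ ≤ ∑' m : ℕ, 8⁻¹ ^ (t + 1) * 2⁻¹ ^ m := by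
      rw [ENNReal.tsum_comm]
      exact ENNReal.tsum_le_tsum fun m => tsum_weight_le hq m (t + 1)
    _ = 8⁻¹ ^ (t + 1) * 2 := by rw [ENNReal.tsum_mul_left, ENNReal.tsum_geometric_two]
    _ ≤ 8⁻¹ * 2 := by
      gcongr
      exact pow_le_of_le_one (by simp) (by simp) (by simp)
    _ = 4⁻¹ := by
      rw [show (8 : ℝ≥0∞) = 4 * 2 by norm_num, ENNReal.mul_inv (by simp) (by simp), mul_assoc,
        ENNReal.inv_mul_cancel (by simp) (by simp), mul_one]

end Bridges

section SparseErgodic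

open scoped ENNReal symmDiff

theorem measure_eq_tsum_fiber {Γ Ω : Type*} [MeasurableSpace Ω] {ν : Measure Ω}
    [Countable Γ] {k : Ω → Γ} (hk : ∀ γ, MeasurableSet {x | k x = γ})
    {A : Set Ω} (hA : MeasurableSet A) : ν A = ∑' γ, ν (A ∩ {x | k x = γ}) := by
  rw [← measure_iUnion]
  · congr 1
    ext x; simp
  · intro γ γ' h
    refine Set.disjoint_left.2 fun x hx hx' => h (hx.2.symm.trans hx'.2)
  · exact fun γ => hA.inter (hk γ)

variable {Γ Ω : Type*} [Group Γ] [MeasurableSpace Ω] [MulAction Γ Ω] {ν : Measure Ω}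
  {q : ℕ → Γ → ℝ≥0∞} {κ : ℕ → Ω → Γ}

theorem IsLabelling.measure_single (hκ : IsLabelling ν q κ) (g : Γ) (i : ℕ) (γ : Γ) :
    ν {x | κ i (g • x) = γ} = q (i + 1) γ := by
  simpa using hκ.measure_eq [((g, i), γ)] (by simp)

theorem IsLabelling.measure_pair (hκ : IsLabelling ν q κ) {g g' : Γ} (hg : g ≠ g') (i : ℕ)
    (γ γ' : Γ) : ν {x | κ i (g • x) = γ ∧ κ i (g' • x) = γ'} = q (i + 1) γ * q (i + 1) γ' := by
  simpa using hκ.measure_eq [((g, i), γ), ((g', i), γ')] (by simp [hg])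

variable [Countable Γ] [MeasurableConstSMul Γ Ω]

theorem measurableSet_moved (hκ : IsLabelling ν q κ) (i : ℕ) {D : Set Ω} (hD : MeasurableSet D) :
    MeasurableSet {x | κ i x • x ∈ D} := by
  have : {x | κ i x • x ∈ D} = ⋃ γ, {x | κ i x = γ} ∩ (fun x => γ • x) ⁻¹' D := by
    ext x; simp
  rw [this]
  exact .iUnion fun γ => (hκ.measurableSet_eq i γ).inter (measurable_const_smul γ hD)

/-- Moving along proposals distorts measure in a uniformly controlled way. -/
theorem IsLabelling.measure_moved_le [SMulInvariantMeasure Γ Ω ν]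
    (hq : IsDecayingSemigroup q) (hκ : IsLabelling ν q κ) (i n : ℕ) {D : Set Ω}
    (hD : MeasurableSet D) : ν {x | κ i x • x ∈ D} ≤ 2 ^ n * ν D + 2⁻¹ ^ n * 2 := by
  classical
  set S : Γ → Set Ω := fun γ => {y | κ i (γ⁻¹ • y) = γ} with hS_def
  have hS : ∀ γ, MeasurableSet (S γ) := fun γ =>
    measurable_const_smul γ⁻¹ (hκ.measurableSet_eq i γ)
  set h : Ω → ℝ≥0∞ := fun y => ∑' γ, (S γ).indicator 1 y with hh
  have hmeas : Measurable h := Measurable.tsum fun γ => measurable_one.indicator (hS γ)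
  have hmm : Measurable fun y => h y * h y := hmeas.mul hmeas
  have h1 : ν {x | κ i x • x ∈ D} = ∫⁻ y in D, h y ∂ν := by
    rw [measure_eq_tsum_fiber (hκ.measurableSet_eq i) (measurableSet_moved hκ i hD),
      lintegral_tsum fun γ => (measurable_one.indicator (hS γ)).aemeasurable]
    refine tsum_congr fun γ => ?_
    rw [lintegral_indicator_one (hS γ), Measure.restrict_apply (hS γ),
      ← measure_preimage_smul ν γ (S γ ∩ D)]
    congr 1
    ext x
    simp only [hS_def, mem_inter_iff, mem_ofPred_eq, mem_preimage, inv_smul_smul]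
    constructor
    · rintro ⟨ha, hb⟩; exact ⟨hb, hb ▸ ha⟩
    · rintro ⟨ha, hb⟩; exact ⟨ha.symm ▸ hb, ha⟩
  have h2 : ∫⁻ y, h y * h y ∂ν ≤ 2 := by
    calc ∫⁻ y, h y * h y ∂ν = ∫⁻ y, ∑' γ, ∑' γ', (S γ ∩ S γ').indicator 1 y ∂ν := by
          refine lintegral_congr fun y => ?_
          simp only [hh]
          rw [← ENNReal.tsum_mul_right]
          refine tsum_congr fun γ => ?_
          rw [← ENNReal.tsum_mul_left]
          refine tsum_congr fun γ' => ?_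
          rw [Set.inter_indicator_one]; rfl
      _ = ∑' γ, ∑' γ', ν (S γ ∩ S γ') := by
          rw [lintegral_tsum fun γ => (Measurable.tsum fun γ' =>
            measurable_one.indicator ((hS γ).inter (hS γ'))).aemeasurable]
          refine tsum_congr fun γ => ?_
          rw [lintegral_tsum fun γ' =>
            (measurable_one.indicator ((hS γ).inter (hS γ'))).aemeasurable]
          exact tsum_congr fun γ' => lintegral_indicator_one ((hS γ).inter (hS γ'))
      _ ≤ ∑' γ, ∑' γ', ((if γ' = γ then q (i + 1) γ else 0) + q (i + 1) γ * q (i + 1) γ') := by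
          refine ENNReal.tsum_le_tsum fun γ => ENNReal.tsum_le_tsum fun γ' => ?_
          by_cases hγ : γ' = γ
          · subst hγ
            rw [if_pos rfl, inter_self]
            exact (hκ.measure_single _ _ _).le.trans le_self_add
          · rw [if_neg hγ, zero_add]
            exact (hκ.measure_pair (by simpa using Ne.symm hγ) _ _ _).le
      _ = 2 := by
          simp only [ENNReal.tsum_add, ENNReal.tsum_mul_left, tsum_ite_eq, hq.tsum_eq, mul_one]
          norm_num
  rw [h1]
  have hcancel : (2⁻¹ ^ n * 2 ^ n : ℝ≥0∞) = 1 := by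
    rw [← mul_pow, ENNReal.inv_mul_cancel (by simp) (by simp), one_pow]
  calc ∫⁻ y in D, h y ∂ν ≤ ∫⁻ y in D, (2 ^ n + 2⁻¹ ^ n * (h y * h y)) ∂ν := by
        refine lintegral_mono fun y => ?_
        simp only
        rcases le_total (h y) (2 ^ n) with hle | hle
        · exact hle.trans le_self_add
        · calc h y = 2⁻¹ ^ n * (2 ^ n * h y) := by rw [← mul_assoc, hcancel, one_mul]
            _ ≤ 2⁻¹ ^ n * (h y * h y) := by gcongr
            _ ≤ _ := le_add_self
    _ = 2 ^ n * ν D + 2⁻¹ ^ n * ∫⁻ y in D, h y * h y ∂ν := by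
        rw [lintegral_add_left measurable_const, lintegral_const, Measure.restrict_apply_univ,
          lintegral_const_mul _ hmm]
    _ ≤ _ := by gcongr; exact (setLIntegral_le_lintegral _ _).trans h2

/-- If every measurable set is approximated by sets that are asymptotically independent of their
translates, then the relation generated by the proposals is ergodic. -/
theorem IsLabelling.isErgodicSubrelation [SMulInvariantMeasure Γ Ω ν] [IsProbabilityMeasure ν]
    [StandardBorelSpace Ω]
    (hq : IsDecayingSemigroup q) (hκ : IsLabelling ν q κ)
    (hmix : ∀ A, MeasurableSet A → ∀ ε : ℝ≥0∞, 0 < ε → ∃ A', MeasurableSet A' ∧ ν (A ∆ A') ≤ ε ∧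
      ∃ bad : Finset Γ, ∀ γ ∉ bad, ∀ i,
        ν (A' ∩ {x | κ i x = γ} ∩ {x | γ • x ∉ A'}) = ν (A' ∩ {x | κ i x = γ}) * ν A'ᶜ) :
    IsErgodicSubrelation Γ ν (sparse κ) where
  equivalence := Relation.EqvGen.is_equivalence _
  orbit _ _ h := orbit_of_sparse h
  measurableSet_smul := hκ.measurableSet_sparse_smul
  ergodic A hA hinv := by
    have hbound : ∀ n : ℕ, ν A * ν Aᶜ ≤ 2⁻¹ ^ n * 7 := by
      intro n
      classical
      obtain ⟨A', hA', hdist, bad, hbad⟩ := hmix A hA (4⁻¹ ^ n) (ENNReal.pow_pos (by simp) n)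
      set ε : ℝ≥0∞ := 4⁻¹ ^ n with hε
      have hD : MeasurableSet (A ∆ A') := hA.symmDiff hA'
      have hstep : ∀ i, 2 ≤ i → ν A' * ν A'ᶜ ≤
          (ε + (2 ^ n * ε + 2⁻¹ ^ n * 2)) + 8⁻¹ ^ (i + 1) * bad.card := by
        intro i hi
        set E : Set Ω := A' ∩ {x | κ i x • x ∈ A'ᶜ} with hE_def
        have hE : MeasurableSet E := hA'.inter (measurableSet_moved hκ i hA'.compl)
        have hle : ν A' * ν A'ᶜ ≤ ν E + 8⁻¹ ^ (i + 1) * bad.card := by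
          rw [measure_eq_tsum_fiber (hκ.measurableSet_eq i) hA', ← ENNReal.tsum_mul_right]
          calc _ ≤ ∑' γ, (ν (E ∩ {x | κ i x = γ}) + if γ ∈ bad then 8⁻¹ ^ (i + 1) else 0) := by
                refine ENNReal.tsum_le_tsum fun γ => ?_
                by_cases hγ : γ ∈ bad
                · rw [if_pos hγ]
                  refine le_add_left ?_
                  calc _ ≤ ν {x | κ i ((1 : Γ) • x) = γ} * 1 := by
                        gcongr
                        · simp
                        · exact prob_le_one
                    _ ≤ _ := by
                        rw [hκ.measure_single, mul_one]; exact hq.le_pow _ _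
                · rw [← hbad γ hγ i]
                  refine le_add_right (measure_mono ?_)
                  rintro x ⟨⟨hx1, hx2⟩, hx3⟩
                  exact ⟨⟨hx1, by rw [← (hx2 : κ i x = γ)] at hx3; exact hx3⟩, hx2⟩
            _ = _ := by
                rw [ENNReal.tsum_add, ← measure_eq_tsum_fiber (hκ.measurableSet_eq i) hE,
                  tsum_eq_sum (s := bad) fun γ hγ => if_neg hγ,
                  Finset.sum_congr rfl fun γ hγ => if_pos hγ, Finset.sum_const, nsmul_eq_mul,
                  mul_comm (bad.card : ℝ≥0∞)]
        refine hle.trans (add_le_add_left ?_ _)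
        have hsub : E ⊆ A ∆ A' ∪ {x | κ i x • x ∈ A ∆ A'} := by
          rintro x ⟨hx, hx'⟩
          have := hinv x (κ i x • x) (Relation.EqvGen.rel _ _ ⟨i, hi, rfl⟩)
          by_cases hxA : x ∈ A
          · exact Or.inr (Or.inl ⟨this.1 hxA, hx'⟩)
          · exact Or.inl (Or.inr ⟨hx, hxA⟩)
        calc ν E ≤ _ := measure_mono hsub
          _ ≤ _ := measure_union_le _ _
          _ ≤ _ := by
            refine add_le_add hdist ((hκ.measure_moved_le hq i n hD).trans ?_)
            gcongr
      have hlim : ν A' * ν A'ᶜ ≤ ε + (2 ^ n * ε + 2⁻¹ ^ n * 2) := by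
        have ht : Filter.Tendsto (fun i : ℕ => (ε + (2 ^ n * ε + 2⁻¹ ^ n * 2)) +
            (8⁻¹ : ℝ≥0∞) ^ (i + 1) * bad.card) Filter.atTop
            (nhds (ε + (2 ^ n * ε + 2⁻¹ ^ n * 2) + 0 * bad.card)) := by
          refine tendsto_const_nhds.add (ENNReal.Tendsto.mul_const ?_ (Or.inr (by simp)))
          exact (ENNReal.tendsto_pow_atTop_nhds_zero_of_lt_one (by simp)).comp
            (Filter.tendsto_add_atTop_nat 1)
        rw [zero_mul, add_zero] at ht
        exact ge_of_tendsto ht ((Filter.eventually_ge_atTop 2).mono hstep)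
      have hA1 : ν A ≤ ν A' + ε := by
        refine le_trans ?_ ((measure_union_le A' (A ∆ A')).trans (by gcongr))
        exact measure_mono fun x hx => by
          by_cases hx' : x ∈ A'
          · exact Or.inl hx'
          · exact Or.inr (Or.inl ⟨hx, hx'⟩)
      have hA2 : ν Aᶜ ≤ ν A'ᶜ + ε := by
        refine le_trans ?_ ((measure_union_le A'ᶜ (A ∆ A')).trans (by gcongr))
        exact measure_mono fun x hx => by
          by_cases hx' : x ∈ A'
          · exact Or.inr (Or.inr ⟨hx', hx⟩)
          · exact Or.inl hx'
      have hε1 : ε ≤ 2⁻¹ ^ n := by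
        refine pow_le_pow_left' (ENNReal.inv_le_inv.2 (by norm_num)) n
      have hε2 : 2 ^ n * ε ≤ 2⁻¹ ^ n := by
        rw [hε, ← mul_pow]
        refine pow_le_pow_left' (le_of_eq ?_) n
        rw [show (4 : ℝ≥0∞) = 2 * 2 by norm_num, ENNReal.mul_inv (by simp) (by simp), ← mul_assoc,
          ENNReal.mul_inv_cancel (by simp) (by simp), one_mul]
      have hε3 : ε ≤ 1 := hε1.trans (pow_le_one₀ zero_le (by simp))
      calc ν A * ν Aᶜ ≤ (ν A' + ε) * (ν A'ᶜ + ε) := mul_le_mul' hA1 hA2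
        _ = ν A' * ν A'ᶜ + (ν A' + ν A'ᶜ + ε) * ε := by ring
        _ ≤ (2⁻¹ ^ n + (2⁻¹ ^ n + 2⁻¹ ^ n * 2)) + (1 + 1 + 1) * 2⁻¹ ^ n := by
          refine add_le_add (hlim.trans (by gcongr)) (mul_le_mul' ?_ hε1)
          exact add_le_add (add_le_add prob_le_one prob_le_one) hε3
        _ = _ := by ring
    have hzero : ν A * ν Aᶜ ≤ 0 := by
      have ht := ENNReal.Tendsto.mul_const (b := (7 : ℝ≥0∞))
        (ENNReal.tendsto_pow_atTop_nhds_zero_of_lt_one (r := 2⁻¹) (by simp)) (Or.inr (by simp))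
      rw [zero_mul] at ht
      exact ge_of_tendsto' ht hbound
    exact mul_eq_zero.1 (nonpos_iff_eq_zero.1 hzero)

end SparseErgodic

section Bernoulli

open ProbabilityTheory
open scoped ENNReal symmDiff

/-- Lebesgue measure on the unit interval, as a measure on the line. -/
def unitLaw : Measure ℝ := volume.restrict (Icc 0 1)

instance : IsProbabilityMeasure unitLaw := ⟨by simp [unitLaw]⟩

/-- A random variable with the uniform law splits every set into pieces of prescribed measure. -/
theorem exists_subset_measure_eq {Ω : Type*} [MeasurableSpace Ω] {ν : Measure Ω}
    [IsProbabilityMeasure ν] {f : Ω → ℝ} (hf : Measurable f) (hmap : ν.map f = unitLaw)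
    {E : Set Ω} (hE : MeasurableSet E) {c : ℝ≥0∞} (hc : c ≤ ν E) :
    ∃ E' ⊆ E, MeasurableSet E' ∧ ν E' = c := by
  have hpre : ∀ S : Set ℝ, MeasurableSet S → ν (f ⁻¹' S) = volume (S ∩ Icc 0 1) := by
    intro S hS
    rw [← Measure.map_apply hf hS, hmap, unitLaw, Measure.restrict_apply hS]
  set F : ℝ → ℝ := fun t => ν.real (E ∩ f ⁻¹' Iic t) with hF
  have hLip : LipschitzWith 1 F := by
    refine LipschitzWith.of_le_add fun t s => ?_
    have h1 : E ∩ f ⁻¹' Iic t ⊆ (E ∩ f ⁻¹' Iic s) ∪ f ⁻¹' Ioc s t := by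
      rintro x ⟨hx, hx'⟩
      rcases le_or_gt (f x) s with h | h
      · exact Or.inl ⟨hx, h⟩
      · exact Or.inr ⟨h, hx'⟩
    have h2 : ν.real (f ⁻¹' Ioc s t) ≤ dist t s := by
      rw [measureReal_def, hpre _ measurableSet_Ioc]
      refine ENNReal.toReal_le_of_le_ofReal dist_nonneg ?_
      refine (measure_mono inter_subset_left).trans ?_
      rw [Real.volume_Ioc]
      exact ENNReal.ofReal_le_ofReal (le_abs_self _)
    exact (measureReal_mono h1).trans ((measureReal_union_le _ _).trans (by gcongr))
  have h0 : F 0 = 0 := by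
    rw [hF]
    simp only [measureReal_def]
    rw [ENNReal.toReal_eq_zero_iff]
    left
    refine measure_mono_null inter_subset_right ?_
    rw [hpre _ measurableSet_Iic]
    have : Iic (0 : ℝ) ∩ Icc 0 1 ⊆ {0} := fun x hx => le_antisymm hx.1 hx.2.1
    exact measure_mono_null this (by simp)
  have h1 : F 1 = ν.real E := by
    simp only [hF, measureReal_def]
    congr 1
    refine measure_inter_conull' (measure_mono_null (t := f ⁻¹' (Iic 1)ᶜ) (fun x hx => hx.2) ?_)
    rw [hpre _ measurableSet_Iic.compl]
    have : (Iic (1 : ℝ))ᶜ ∩ Icc 0 1 = ∅ := by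
      ext x; simp only [mem_inter_iff, mem_compl_iff, mem_Iic, mem_Icc, mem_empty_iff_false]
      tauto
    rw [this, measure_empty]
  obtain ⟨t, -, ht⟩ := intermediate_value_Icc zero_le_one hLip.continuous.continuousOn
    (show c.toReal ∈ Icc (F 0) (F 1) by
      rw [h0, h1]
      exact ⟨ENNReal.toReal_nonneg, ENNReal.toReal_mono (measure_ne_top _ _) hc⟩)
  refine ⟨E ∩ f ⁻¹' Iic t, inter_subset_left, hE.inter (hf measurableSet_Iic), ?_⟩
  exact (ENNReal.toReal_eq_toReal_iff' (measure_ne_top _ _)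
    (ne_top_of_le_ne_top (measure_ne_top _ _) hc)).1 ht

/-- A uniform random variable can be turned into independent variables of prescribed laws. -/
theorem exists_iIndepFun_unitLaw {Γ : Type*} [Countable Γ] [Nonempty Γ] [MeasurableSpace Γ]
    [MeasurableSingletonClass Γ] {q : ℕ → Γ → ℝ≥0∞} (hq : ∀ n, ∑' g, q n g = 1) :
    ∃ k : ℕ → ℝ → Γ, (∀ i, Measurable (k i)) ∧ (∀ i γ, unitLaw {t | k i t = γ} = q i γ) ∧
      iIndepFun k unitLaw := by
  set p : ℕ → PMF Γ := fun i => ⟨q i, hq i ▸ ENNReal.summable.hasSum⟩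
  set P : ℕ → Measure Γ := fun i => (p i).toMeasure with hP
  have : ∀ i, IsProbabilityMeasure (P i) := fun i => PMF.toMeasure.isProbabilityMeasure (p i)
  obtain ⟨f, hf, hmap⟩ := (Measure.infinitePi P).exists_measurable_map_eq
  have hproj : Measurable (Set.projIcc (0 : ℝ) 1 zero_le_one) := continuous_projIcc.measurable
  have hk : Measurable fun t i => f (Set.projIcc (0 : ℝ) 1 zero_le_one t) i := hf.comp hproj
  have hlaw : unitLaw.map (fun t i => f (Set.projIcc (0 : ℝ) 1 zero_le_one t) i) =
      Measure.infinitePi P := by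
    rw [← hmap, unitLaw, ← map_comap_subtype_coe measurableSet_Icc,
      Measure.map_map hk measurable_subtype_coe]
    congr 1
    ext t i
    simp
  have hlaw' : ∀ i, unitLaw.map (fun t => f (Set.projIcc (0 : ℝ) 1 zero_le_one t) i) = P i := by
    intro i
    rw [← Measure.infinitePi_map_eval P i, ← hlaw, Measure.map_map (measurable_pi_apply i) hk]
    rfl
  have hk' : ∀ i, Measurable fun t => f (Set.projIcc (0 : ℝ) 1 zero_le_one t) i := fun i =>
    (measurable_pi_apply i).comp hk
  refine ⟨fun i t => f (Set.projIcc (0 : ℝ) 1 zero_le_one t) i, hk', fun i γ => ?_, ?_⟩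
  · refine (Measure.map_apply (μ := unitLaw) (hk' i) (measurableSet_singleton γ)).symm.trans ?_
    rw [hlaw' i]
    exact PMF.toMeasure_apply_singleton _ _ (measurableSet_singleton γ)
  · rw [iIndepFun_iff_map_fun_eq_infinitePi_map hk', hlaw]
    exact congrArg Measure.infinitePi (funext fun i => (hlaw' i).symm)

variable {Γ : Type*} [Group Γ]

instance bernoulliAction : MulAction Γ (Γ → ℝ) where
  smul := bernoulliShift
  one_smul x := by
    change bernoulliShift 1 x = x
    ext h; simp [bernoulliShift]
  mul_smul g g' x := by
    change bernoulliShift (g * g') x = bernoulliShift g (bernoulliShift g' x)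
    ext h; simp [bernoulliShift, mul_assoc]

theorem bernoulli_smul_apply (g : Γ) (x : Γ → ℝ) (h : Γ) : (g • x) h = x (g⁻¹ * h) := rfl

/-- The product measure on the Bernoulli space. -/
def bernoulliMeasure (Γ : Type*) : Measure (Γ → ℝ) := Measure.infinitePi fun _ => unitLaw

instance {Γ : Type*} : IsProbabilityMeasure (bernoulliMeasure Γ) := by
  rw [bernoulliMeasure]; infer_instance

theorem _root_.IsBernoulliLebProduct.eq_bernoulliMeasure {Γ : Type*} {m : Measure (Γ → ℝ)}
    (hm : IsBernoulliLebProduct m) : m = bernoulliMeasure Γ := by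
  refine Measure.eq_infinitePi _ fun s t ht => ?_
  refine (hm.2 s t ht).trans (Finset.prod_congr rfl fun i _ => ?_)
  rw [unitLaw, Measure.restrict_apply (ht i)]

theorem iIndepFun_bernoulliMeasure {Γ : Type*} :
    iIndepFun (fun (g : Γ) (x : Γ → ℝ) => x g) (bernoulliMeasure Γ) :=
  iIndepFun_infinitePi (P := fun _ => unitLaw) (X := fun _ t => t) fun _ => measurable_id

theorem bernoulliMeasure_map_eval {Γ : Type*} (g : Γ) :
    (bernoulliMeasure Γ).map (fun x => x g) = unitLaw :=
  Measure.infinitePi_map_eval (fun _ => unitLaw) g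

instance : MeasurableConstSMul Γ (Γ → ℝ) where
  measurable_const_smul g := measurable_pi_lambda _ fun h => measurable_pi_apply (g⁻¹ * h)

instance : SMulInvariantMeasure Γ (Γ → ℝ) (bernoulliMeasure Γ) where
  measure_preimage_smul g s hs := by
    rw [← Measure.map_apply (measurable_const_smul g) hs]
    congr 1
    exact Measure.map_infinitePi_infinitePi_of_inj (P := fun _ => unitLaw)
      (mul_right_injective g⁻¹)

theorem bernoulliMeasure_eval_eq {Γ : Type*} {u v : Γ} (huv : u ≠ v) :
    bernoulliMeasure Γ {x | x u = x v} = 0 := by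
  have h := Measure.infinitePi_map_eval_prod (P := fun _ : Γ => unitLaw) huv
  have hd : MeasurableSet {p : ℝ × ℝ | p.1 = p.2} :=
    measurableSet_eq_fun measurable_fst measurable_snd
  have h2 : bernoulliMeasure Γ {x | x u = x v} = (unitLaw.prod unitLaw) {p | p.1 = p.2} := by
    rw [← h, Measure.map_apply (by fun_prop) hd]; rfl
  rw [h2, Measure.measure_prod_null hd]
  refine Filter.Eventually.of_forall fun t => ?_
  have : Prod.mk t ⁻¹' {p : ℝ × ℝ | p.1 = p.2} = {t} := by ext s; simp [eq_comm]
  change unitLaw (Prod.mk t ⁻¹' _) = 0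
  rw [this, unitLaw, measure_singleton]

theorem bernoulli_free [Countable Γ] :
    ∀ᵐ x ∂bernoulliMeasure Γ, ∀ g : Γ, g • x = x → g = 1 := by
  rw [ae_all_iff]
  intro g
  by_cases hg : g = 1
  · exact Filter.Eventually.of_forall fun _ _ => hg
  · have : ∀ᵐ x ∂bernoulliMeasure Γ, x g⁻¹ ≠ x 1 := by
      rw [ae_iff]
      simpa using bernoulliMeasure_eval_eq (show g⁻¹ ≠ 1 by simpa using hg)
    filter_upwards [this] with x hx hgx
    refine absurd ?_ hx
    simpa [bernoulli_smul_apply] using congrFun hgx 1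

variable {q : ℕ → Γ → ℝ≥0∞} [MeasurableSpace Γ] [MeasurableSingletonClass Γ]

theorem isLabelling_bernoulli {k : ℕ → ℝ → Γ} (hk : ∀ i, Measurable (k i))
    (hlaw : ∀ i γ, unitLaw {t | k i t = γ} = q (i + 1) γ) (hind : iIndepFun k unitLaw) :
    IsLabelling (bernoulliMeasure Γ) q fun i x => k i (x 1) where
  measurableSet_eq i γ := ((hk i).comp (measurable_pi_apply 1)) (measurableSet_singleton γ)
  measure_eq L hL := by
    classical
    have hsingle : ∀ g i γ, bernoulliMeasure Γ {x | k i (x g) = γ} = q (i + 1) γ := by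
      intro g i γ
      have hS : MeasurableSet {t | k i t = γ} := hk i (measurableSet_singleton γ)
      rw [← hlaw, ← bernoulliMeasure_map_eval g, Measure.map_apply (measurable_pi_apply g) hS]
      rfl
    have h1 : iIndepFun (fun (g : Γ) (x : Γ → ℝ) i => k i (x g⁻¹)) (bernoulliMeasure Γ) :=
      (iIndepFun_bernoulliMeasure.precomp inv_injective).comp (fun _ t i => k i t)
        fun _ => measurable_pi_lambda _ hk
    have h2 : ∀ g : Γ, iIndepFun (fun i (x : Γ → ℝ) => k i (x g⁻¹)) (bernoulliMeasure Γ) := by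
      intro g
      have hm : ∀ i, Measurable fun x : Γ → ℝ => k i (x g⁻¹) := fun i =>
        (hk i).comp (measurable_pi_apply _)
      rw [iIndepFun_iff_map_fun_eq_infinitePi_map hk] at hind
      rw [iIndepFun_iff_map_fun_eq_infinitePi_map hm]
      have hc : ∀ i, (bernoulliMeasure Γ).map (fun x => k i (x g⁻¹)) = unitLaw.map (k i) := by
        intro i
        rw [← bernoulliMeasure_map_eval g⁻¹, Measure.map_map (hk i) (measurable_pi_apply _)]
        rfl
      simp only [hc]
      rw [← hind, ← bernoulliMeasure_map_eval g⁻¹,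
        Measure.map_map (measurable_pi_lambda _ hk) (measurable_pi_apply _)]
      rfl
    have h3 : iIndepFun (fun (p : Γ × ℕ) (x : Γ → ℝ) => k p.2 (x p.1⁻¹)) (bernoulliMeasure Γ) :=
      iIndepFun_uncurry' (X := fun (g : Γ) i (x : Γ → ℝ) => k i (x g⁻¹))
        (fun g i => (hk i).comp (measurable_pi_apply _)) h1 h2
    have hchoice : ∀ p ∈ L.map Prod.fst, ∃ γ, (p, γ) ∈ L := by
      intro p hp
      obtain ⟨e, he, rfl⟩ := List.mem_map.1 hp
      exact ⟨e.2, he⟩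
    set c : Γ × ℕ → Γ := fun p => if hp : p ∈ L.map Prod.fst then (hchoice p hp).choose else 1
      with hc_def
    have hc : ∀ e ∈ L, c e.1 = e.2 := by
      intro e he
      have hp : e.1 ∈ L.map Prod.fst := List.mem_map_of_mem he
      have h4 : (e.1, c e.1) ∈ L := by
        rw [hc_def]; simp only [dif_pos hp]; exact (hchoice e.1 hp).choose_spec
      exact congrArg Prod.snd (List.inj_on_of_nodup_map hL h4 he rfl)
    have h5 := h3.measure_inter_preimage_eq_mul (L.map Prod.fst).toFinset
      (sets := fun p => {c p}) fun p _ => measurableSet_singleton _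
    have h6 : {x : Γ → ℝ | ∀ e ∈ L, k e.1.2 ((e.1.1 • x) 1) = e.2} =
        ⋂ p ∈ (L.map Prod.fst).toFinset, (fun x : Γ → ℝ => k p.2 (x p.1⁻¹)) ⁻¹' {c p} := by
      ext x
      simp only [mem_ofPred_eq, mem_iInter, List.mem_toFinset, List.mem_map, mem_preimage,
        mem_singleton_iff, bernoulli_smul_apply, mul_one]
      constructor
      · rintro h p ⟨e, he, rfl⟩
        rw [hc e he]; exact h e he
      · intro h e he
        rw [← hc e he]; exact h e.1 ⟨e, he, rfl⟩
    rw [h6, h5, List.prod_toFinset _ hL, List.map_map]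
    congr 1
    refine List.map_congr_left fun e he => ?_
    simp only [Function.comp_apply]
    rw [hc e he]
    exact hsingle _ _ _

theorem bernoulli_mixing {k : ℕ → ℝ → Γ} (hk : ∀ i, Measurable (k i)) {A : Set (Γ → ℝ)}
    (hA : MeasurableSet A) {ε : ℝ≥0∞} (hε : 0 < ε) :
    ∃ A', MeasurableSet A' ∧ bernoulliMeasure Γ (A ∆ A') ≤ ε ∧
      ∃ bad : Finset Γ, ∀ γ ∉ bad, ∀ i,
        bernoulliMeasure Γ (A' ∩ {x | k i (x 1) = γ} ∩ {x | γ • x ∉ A'}) =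
          bernoulliMeasure Γ (A' ∩ {x | k i (x 1) = γ}) * bernoulliMeasure Γ A'ᶜ := by
  classical
  have hdense : (bernoulliMeasure Γ).MeasureDense (measurableCylinders fun _ : Γ => ℝ) :=
    .of_generateFrom_isSetAlgebra_finite _ isSetAlgebra_measurableCylinders
      generateFrom_measurableCylinders.symm
  obtain ⟨δ, hδ, hδε⟩ : ∃ δ : ℝ, 0 < δ ∧ ENNReal.ofReal δ ≤ ε := by
    obtain ⟨δ, hδ, hδε⟩ := ENNReal.lt_iff_exists_nnreal_btwn.1 hε
    exact ⟨δ, by exact_mod_cast hδ, by simpa using hδε.le⟩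
  obtain ⟨A', hA'cyl, hdist⟩ := hdense.approx A hA (measure_ne_top _ _) δ hδ
  have hA' : MeasurableSet A' := hdense.measurable _ hA'cyl
  obtain ⟨W, S, hS, rfl⟩ := (mem_measurableCylinders _).1 hA'cyl
  refine ⟨_, hA', hdist.le.trans hδε,
    Finset.image₂ (fun w v => w * v⁻¹) W (insert 1 W), fun γ hγ i => ?_⟩
  have hdisj : Disjoint (insert 1 W) (W.image (γ⁻¹ * ·)) := by
    rw [Finset.disjoint_left]
    intro v hv hv'
    obtain ⟨w, hw, rfl⟩ := Finset.mem_image.1 hv'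
    exact hγ (Finset.mem_image₂.2 ⟨w, hw, _, hv, by group⟩)
  have hindep := iIndepFun_bernoulliMeasure.indepFun_finset _ _ hdisj fun g => measurable_pi_apply g
  set S₁ : Set ((insert 1 W : Finset Γ) → ℝ) := {s |
    (fun w : W => s ⟨w, Finset.mem_insert_of_mem w.2⟩) ∈ S ∧
      k i (s ⟨1, Finset.mem_insert_self 1 W⟩) = γ} with hS₁
  set S₂ : Set ((W.image (γ⁻¹ * ·) : Finset Γ) → ℝ) := {s |
    (fun w : W => s ⟨γ⁻¹ * w, Finset.mem_image_of_mem _ w.2⟩) ∉ S} with hS₂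
  have hS₁m : MeasurableSet S₁ := by
    refine MeasurableSet.inter ?_ ?_
    · exact measurableSet_preimage (measurable_pi_lambda _ fun w => measurable_pi_apply _) hS
    · exact measurableSet_preimage ((hk i).comp (measurable_pi_apply _))
        (measurableSet_singleton γ)
  have hS₂m : MeasurableSet S₂ :=
    (measurableSet_preimage (measurable_pi_lambda _ fun w => measurable_pi_apply _) hS).compl
  have hmul := hindep.measure_inter_preimage_eq_mul _ _ hS₁m hS₂m
  have hinv : bernoulliMeasure Γ ((fun x : Γ → ℝ => γ • x) ⁻¹' (cylinder W S)ᶜ) =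
      bernoulliMeasure Γ (cylinder W S)ᶜ := measure_preimage_smul _ _ _
  rw [← hinv]
  exact hmul

end Bernoulli

theorem exists_dense_sequence {Ω : Type*} [MeasurableSpace Ω] [MeasurableSpace.CountablyGenerated Ω]
    (ν : Measure Ω) [IsFiniteMeasure ν] : ∃ B : ℕ → Set Ω, (∀ j, MeasurableSet (B j)) ∧
      ∀ A, MeasurableSet A → ∀ ε : ENNReal, 0 < ε → ∃ j, ν (symmDiff A (B j)) ≤ ε := by
  obtain ⟨𝒜, hcount, hdense⟩ := exists_countable_measureDense ν
  obtain ⟨B, rfl⟩ := hcount.exists_eq_range hdense.nonempty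
  refine ⟨B, fun j => hdense.measurable _ (mem_range_self j), fun A hA ε hε => ?_⟩
  obtain ⟨δ, hδ, hδε⟩ := ENNReal.lt_iff_exists_nnreal_btwn.1 hε
  obtain ⟨-, ⟨j, rfl⟩, hj⟩ := hdense.approx A hA (measure_ne_top _ _) δ (by exact_mod_cast hδ)
  exact ⟨j, hj.le.trans (by simpa using hδε.le)⟩

theorem exists_pmpAction_bernoulli {Γ : Type*} [Group Γ] [Countable Γ] (hna : ¬ IsAmenable Γ) :
    ∃ A : PmpAction (FreeGroup (Fin 2)) (Γ → ℝ) (bernoulliMeasure Γ),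
      A.IsFree ∧ A.IsErgodic ∧ A.orbitRel ⊆ {q | ∃ g : Γ, q.2 = g • q.1} := by
  obtain ⟨q, hq⟩ := exists_isDecayingSemigroup hna
  let _ : MeasurableSpace Γ := ⊤
  obtain ⟨k, hk, hlaw, hind⟩ := exists_iIndepFun_unitLaw fun n => hq.tsum_eq (n + 1)
  have hκ := isLabelling_bernoulli hk hlaw hind
  obtain ⟨B, hB, hdense⟩ := exists_dense_sequence (bernoulliMeasure Γ)
  have hbridges : ∀ t, 3 / 4 ≤ bernoulliMeasure Γ (bridges (fun i x => k i (x 1)) t) := by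
    intro t
    have h := hκ.measure_compl_bridges_le hq bernoulli_free t
    have h1 : (1 : ENNReal) ≤ bernoulliMeasure Γ (bridges (fun i x => k i (x 1)) t) + 4⁻¹ := by
      rw [← prob_add_prob_compl (μ := bernoulliMeasure Γ) (hκ.measurableSet_bridges t)]
      gcongr
    have h2 : (3 / 4 : ENNReal) = 1 - 4⁻¹ := by
      refine ENNReal.eq_sub_of_add_eq (by simp) ?_
      rw [ENNReal.div_eq_inv_mul]
      nth_rewrite 2 [← mul_one (4⁻¹ : ENNReal)]
      rw [← mul_add, show (3 + 1 : ENNReal) = 4 by norm_num,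
        ENNReal.inv_mul_cancel (by simp) (by simp)]
    rw [h2]
    exact tsub_le_iff_right.2 h1
  refine exists_pmpAction
    (fun E hE c hc => exists_subset_measure_eq (measurable_pi_apply (1 : Γ))
      (bernoulliMeasure_map_eval 1) hE hc)
    hB hdense
    (hκ.isErgodicSubrelation hq fun A hA ε hε => bernoulli_mixing hk hA hε)
    (V := fun t => bridges (fun i (x : Γ → ℝ) => k i (x 1)) t.toNat)
    (fun t => hκ.measurableSet_bridges t.toNat)
    (φ := fun t (x : Γ → ℝ) => k t.toNat (x 1)) (fun t γ => hκ.measurableSet_eq t.toNat γ) ?_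
    fun t v hv => not_eqvGen_of_mem_bridges (κ := fun i (x : Γ → ℝ) => k i (x 1)) hv
  refine lt_of_lt_of_le ?_ (add_le_add (hbridges _) (hbridges _))
  rw [ENNReal.div_add_div_same]
  refine (ENNReal.lt_div_iff_mul_lt (by simp) (by simp)).2 ?_
  norm_num

end GaboriauLyons

/-- Gaboriau–Lyons: for any nonamenable countable discrete group `Γ` there is a free ergodic
pmp action of the free group `F₂` on `([0,1]^Γ, Leb^Γ)` whose orbit equivalence relation is
contained in that of the Bernoulli shift of `Γ`. -/
theorem gaboriau_lyons (Γ : Type) [Group Γ] [Countable Γ] (hna : ¬ IsAmenable Γ)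
    (μ : Measure (Γ → ℝ)) (hμ : IsBernoulliLebProduct μ) :
    ∃ A : PmpAction (FreeGroup (Fin 2)) (Γ → ℝ) μ,
      A.IsFree ∧ A.IsErgodic ∧
      A.orbitRel ⊆ {q | ∃ g : Γ, q.2 = bernoulliShift g q.1} := by
  rw [hμ.eq_bernoulliMeasure]
  exact GaboriauLyons.exists_pmpAction_bernoulli hna

end
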